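/- arXiv:1909.11441 — 3 statements merged into one kernel-verified Lean document; each statement's English description precedes it below -/
import Mathlib

section
/- Let N ≥ 2 and 1 < α < N. For every ε > 0 there exists a constant K = K(N, α, ε) > 0 such that for every measurable set E ⊆ ℝ^N with |E| = ω_N, either δ(E) ≤ K·√(D(E)), or there exists an ε-nearly spherical set Ẽ around the unit ball B, with barycenter at the origin, satisfying D(Ẽ) ≤ 2·D(E) and |Ẽ Δ B| ≥ δ(E)/6. -/
open MeasureTheory Metric
open scoped symmDiff

noncomputable def rieszEnergy (N : ℕ) (α : ℝ) (E : Set (EuclideanSpace ℝ (Fin N))) : ℝ :=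
  ∫ x in E, ∫ y in E, ‖y - x‖ ^ (α - (N : ℝ))

noncomputable def deficit (N : ℕ) (α : ℝ) (E : Set (EuclideanSpace ℝ (Fin N))) : ℝ :=
  rieszEnergy N α (ball (0 : EuclideanSpace ℝ (Fin N)) 1) - rieszEnergy N α E

noncomputable def asymmetry (N : ℕ) (E : Set (EuclideanSpace ℝ (Fin N))) : ℝ :=
  ⨅ x : EuclideanSpace ℝ (Fin N), (volume (ball x 1 ∆ E)).toReal

noncomputable def barycenter (N : ℕ) (F : Set (EuclideanSpace ℝ (Fin N))) :
    EuclideanSpace ℝ (Fin N) :=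
  ((volume F).toReal)⁻¹ • ∫ x in F, x

/-- `S` is an `ε`-nearly spherical set around the unit ball centered at `z`:
its boundary is the graph over `∂B` of a measurable function `u` with values in `(-ε, ε)`. -/
def IsNearlySpherical (N : ℕ) (ε : ℝ) (z : EuclideanSpace ℝ (Fin N))
    (S : Set (EuclideanSpace ℝ (Fin N))) : Prop :=
  volume S = volume (ball (0 : EuclideanSpace ℝ (Fin N)) 1) ∧
  ∃ u : EuclideanSpace ℝ (Fin N) → ℝ, Measurable u ∧
    (∀ x ∈ sphere (0 : EuclideanSpace ℝ (Fin N)) 1, u x ∈ Set.Ioo (-ε) ε) ∧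
    S = {p | ∃ x ∈ sphere (0 : EuclideanSpace ℝ (Fin N)) 1,
          ∃ ρ : ℝ, -1 ≤ ρ ∧ ρ ≤ u x ∧ p = z + (1 + ρ) • x}

section

set_option linter.unusedSectionVars false

open Module Set
open scoped ENNReal RealInnerProductSpace

variable {V : Type*} [NormedAddCommGroup V] [InnerProductSpace ℝ V] [FiniteDimensional ℝ V]
  [MeasurableSpace V] [BorelSpace V]

/-- The Riesz kernel `‖x - y‖ ^ (-s)` with values in `[0, ∞]`. -/
noncomputable def rieszKernel (s : ℝ) (x y : V) : ℝ≥0∞ :=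
  ENNReal.ofReal (‖x - y‖ ^ (-s))

/-- The mutual Riesz energy of two sets. -/
noncomputable def mutualEnergy (s : ℝ) (A B : Set V) : ℝ≥0∞ :=
  ∫⁻ x in A, ∫⁻ y in B, rieszKernel s x y

theorem measurable_rieszKernel (s : ℝ) :
    Measurable fun p : V × V ↦ rieszKernel s p.1 p.2 := by
  unfold rieszKernel
  fun_prop

theorem rieszKernel_comm (s : ℝ) (x y : V) : rieszKernel s x y = rieszKernel s y x := by
  simp only [rieszKernel, norm_sub_rev x y]

theorem measurable_rieszKernel_right (s : ℝ) (x : V) : Measurable (rieszKernel s x) :=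
  (measurable_rieszKernel s).comp measurable_prodMk_left

theorem measurable_potential (s : ℝ) (A : Set V) :
    Measurable fun x : V ↦ ∫⁻ y in A, rieszKernel s x y :=
  (measurable_rieszKernel s).lintegral_prod_right'

theorem mutualEnergy_comm (s : ℝ) (A B : Set V) : mutualEnergy s A B = mutualEnergy s B A := by
  unfold mutualEnergy
  rw [lintegral_lintegral_swap (measurable_rieszKernel s).aemeasurable]
  simp only [rieszKernel_comm]

theorem mutualEnergy_mono (s : ℝ) {A A' B B' : Set V} (hA : A ⊆ A') (hB : B ⊆ B') :
    mutualEnergy s A B ≤ mutualEnergy s A' B' :=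
  (lintegral_mono_set hA).trans (lintegral_mono fun _ ↦ lintegral_mono_set hB)

theorem mutualEnergy_union_left (s : ℝ) {A A' : Set V} (B : Set V) (hA' : MeasurableSet A')
    (h : Disjoint A A') :
    mutualEnergy s (A ∪ A') B = mutualEnergy s A B + mutualEnergy s A' B :=
  lintegral_union hA' h

theorem mutualEnergy_union_right (s : ℝ) (A : Set V) {B B' : Set V} (hB' : MeasurableSet B')
    (h : Disjoint B B') :
    mutualEnergy s A (B ∪ B') = mutualEnergy s A B + mutualEnergy s A B' := by
  rw [mutualEnergy_comm, mutualEnergy_union_left s A hB' h, mutualEnergy_comm s B,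
    mutualEnergy_comm s B']

theorem mutualEnergy_self_union (s : ℝ) {A B : Set V} (hB : MeasurableSet B)
    (h : Disjoint A B) :
    mutualEnergy s (A ∪ B) (A ∪ B) =
      mutualEnergy s A A + 2 * mutualEnergy s A B + mutualEnergy s B B := by
  rw [mutualEnergy_union_left s _ hB h, mutualEnergy_union_right s A hB h,
    mutualEnergy_union_right s B hB h, mutualEnergy_comm s B A]
  ring

theorem mutualEnergy_preimage (s : ℝ) {σ : V → V} (hσ : MeasurePreserving σ volume volume)
    (hn : ∀ x y, ‖σ x - σ y‖ = ‖x - y‖) {A B : Set V} (hA : MeasurableSet A)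
    (hB : MeasurableSet B) :
    mutualEnergy s (σ ⁻¹' A) (σ ⁻¹' B) = mutualEnergy s A B := by
  unfold mutualEnergy
  rw [← hσ.setLIntegral_comp_preimage hA (measurable_potential s B)]
  congr 1 with x
  rw [← hσ.setLIntegral_comp_preimage hB (measurable_rieszKernel_right s (σ x))]
  simp only [rieszKernel, hn]

theorem lintegral_preimage_smul {r : ℝ} (hr : 0 < r) {A : Set V} (hA : MeasurableSet A)
    {f : V → ℝ≥0∞} (hf : Measurable f) :
    ∫⁻ x in (r • ·) ⁻¹' A, f (r • x) =
      ENNReal.ofReal ((r ^ finrank ℝ V)⁻¹) * ∫⁻ x in A, f x := by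
  have h := Measure.map_addHaar_smul (volume : Measure V) hr.ne'
  have hm : Measurable fun x : V ↦ r • x := measurable_const_smul r
  rw [← setLIntegral_map hA hf hm, h, Measure.restrict_smul, lintegral_smul_measure,
    abs_of_nonneg (by positivity), smul_eq_mul]

theorem mutualEnergy_preimage_smul (s : ℝ) {r : ℝ} (hr : 0 < r) {A : Set V}
    (hA : MeasurableSet A) :
    mutualEnergy s ((r • ·) ⁻¹' A) ((r • ·) ⁻¹' A) =
      ENNReal.ofReal (r ^ s * ((r ^ finrank ℝ V)⁻¹) ^ 2) * mutualEnergy s A A := by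
  have key : ∀ x : V, ∫⁻ y in (r • ·) ⁻¹' A, rieszKernel s x y =
      ENNReal.ofReal (r ^ s * (r ^ finrank ℝ V)⁻¹) * ∫⁻ y in A, rieszKernel s (r • x) y := by
    intro x
    have : ∀ y, rieszKernel s x y = ENNReal.ofReal (r ^ s) * rieszKernel s (r • x) (r • y) := by
      intro y
      unfold rieszKernel
      rw [← ENNReal.ofReal_mul (by positivity), ← smul_sub, norm_smul, Real.norm_of_nonneg hr.le,
        Real.mul_rpow hr.le (norm_nonneg _), ← mul_assoc, ← Real.rpow_add hr]
      simp
    simp_rw [this]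
    have hm : Measurable fun y : V ↦ rieszKernel s (r • x) (r • y) :=
      (measurable_rieszKernel_right s _).comp (measurable_const_smul r)
    rw [lintegral_const_mul _ hm, lintegral_preimage_smul hr hA (measurable_rieszKernel_right s _), ← mul_assoc,
      ← ENNReal.ofReal_mul (by positivity)]
  unfold mutualEnergy
  simp_rw [key]
  have hm : Measurable fun x : V ↦ ∫⁻ y in A, rieszKernel s (r • x) y :=
    (measurable_potential s A).comp (measurable_const_smul r)
  rw [lintegral_const_mul _ hm, lintegral_preimage_smul hr hA (measurable_potential s A), ← mul_assoc,
      ← ENNReal.ofReal_mul (by positivity)]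
  congr 2
  ring

theorem volume_preimage_smul {r : ℝ} (hr : 0 < r) {A : Set V} (hA : MeasurableSet A) :
    volume ((r • ·) ⁻¹' A : Set V) = ENNReal.ofReal ((r ^ finrank ℝ V)⁻¹) * volume A := by
  have := lintegral_preimage_smul hr hA (f := fun _ ↦ 1) measurable_const
  simpa using this

theorem lintegral_rieszKernel_sub (s : ℝ) (x : V) {A : Set V} (hA : MeasurableSet A) :
    ∫⁻ y in A, rieszKernel s x y = ∫⁻ y in (x + ·) ⁻¹' A, rieszKernel s 0 y := by
  rw [← (measurePreserving_add_left volume x).setLIntegral_comp_preimage hA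
    (measurable_rieszKernel_right s x)]
  simp [rieszKernel]

theorem lintegral_ball_rieszKernel_lt_top [Nontrivial V] {s : ℝ} (hs : s < finrank ℝ V) (L : ℝ) :
    ∫⁻ y in ball 0 L, rieszKernel s (0 : V) y < ∞ := by
  have h := integrableOn_ball_of_norm_le_rpow (μ := (volume : Measure V)) (C := 1) (r := L)
    (f := fun x : V ↦ ‖x‖ ^ (-s)) finrank_pos hs
    (.of_forall fun x ↦ by rw [one_mul, Real.norm_of_nonneg (by positivity)])
    (measurable_norm.pow_const _).aestronglyMeasurable
  have h2 := h.2
  rw [hasFiniteIntegral_iff_ofReal (.of_forall fun x ↦ by positivity)] at h2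
  simpa [rieszKernel] using h2

theorem rieszKernel_le_of_le_norm {s L : ℝ} (hs : 0 < s) (hL : 0 < L) {x y : V}
    (h : L ≤ ‖x - y‖) : rieszKernel s x y ≤ ENNReal.ofReal (L ^ (-s)) :=
  ENNReal.ofReal_le_ofReal (Real.rpow_le_rpow_of_nonpos hL h (by linarith))

theorem le_rieszKernel_of_norm_le {s L : ℝ} (hs : 0 < s) {x y : V} (hxy : x ≠ y)
    (h : ‖x - y‖ ≤ L) : ENNReal.ofReal (L ^ (-s)) ≤ rieszKernel s x y :=
  ENNReal.ofReal_le_ofReal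
    (Real.rpow_le_rpow_of_nonpos (norm_pos_iff.2 (sub_ne_zero.2 hxy)) h (by linarith))

theorem potential_diff_ball_le {s L : ℝ} (hs : 0 < s) (hL : 0 < L) (x : V) {A : Set V}
    (hA : MeasurableSet A) :
    ∫⁻ y in A \ ball x L, rieszKernel s x y ≤ ENNReal.ofReal (L ^ (-s)) * volume A := by
  calc ∫⁻ y in A \ ball x L, rieszKernel s x y
      ≤ ∫⁻ y in A \ ball x L, ENNReal.ofReal (L ^ (-s)) := by
        refine setLIntegral_mono' (hA.diff measurableSet_ball) fun y hy ↦ ?_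
        refine rieszKernel_le_of_le_norm hs hL ?_
        have := hy.2
        rw [mem_ball, dist_comm, dist_eq_norm, not_lt] at this
        exact this
    _ = ENNReal.ofReal (L ^ (-s)) * volume (A \ ball x L) := by simp
    _ ≤ _ := by gcongr; exact sdiff_subset

/-- Riesz potentials of sets are bounded in terms of the volume. -/
theorem exists_potential_le [Nontrivial V] {s : ℝ} (hs : 0 < s) (hs' : s < finrank ℝ V) :
    ∃ C : ℝ≥0∞, C ≠ ∞ ∧ ∀ (A : Set V) (x : V), MeasurableSet A →
      ∫⁻ y in A, rieszKernel s x y ≤ C + volume A := by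
  refine ⟨∫⁻ y in ball 0 1, rieszKernel s (0 : V) y, (lintegral_ball_rieszKernel_lt_top hs' 1).ne,
    fun A x hA ↦ ?_⟩
  rw [← lintegral_inter_add_sdiff _ A (measurableSet_ball (x := x) (ε := 1))]
  refine add_le_add ?_ ?_
  · calc _ ≤ ∫⁻ y in ball x 1, rieszKernel s x y := lintegral_mono_set inter_subset_right
      _ = _ := by
        rw [lintegral_rieszKernel_sub s x measurableSet_ball]
        congr 2
        ext y; simp
  · simpa using potential_diff_ball_le hs one_pos x hA

/-- Sets of small volume near a point have small potential at this point. -/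
theorem exists_potential_lt_of_volume_lt [Nontrivial V] {s : ℝ} (hs' : s < finrank ℝ V) (L : ℝ)
    {θ : ℝ≥0∞} (hθ : θ ≠ 0) :
    ∃ c : ℝ≥0∞, 0 < c ∧ ∀ (A : Set V) (x : V), MeasurableSet A → volume (A ∩ ball x L) < c →
      ∫⁻ y in A ∩ ball x L, rieszKernel s x y < θ := by
  obtain ⟨c, hc, h⟩ := exists_pos_setLIntegral_lt_of_measure_lt
    (lintegral_ball_rieszKernel_lt_top (V := V) hs' L).ne hθ
  refine ⟨c, hc, fun A x hA hAc ↦ ?_⟩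
  have hm := hA.inter (measurableSet_ball (x := x) (ε := L))
  have hsub : (x + ·) ⁻¹' (A ∩ ball x L) ⊆ ball (0 : V) L := by
    intro y hy
    simpa using hy.2
  have hv : volume ((x + ·) ⁻¹' (A ∩ ball x L)) < c := by
    rwa [(measurePreserving_add_left volume x).measure_preimage hm.nullMeasurableSet]
  rw [lintegral_rieszKernel_sub s x hm]
  have := h ((x + ·) ⁻¹' (A ∩ ball x L)) ((Measure.restrict_apply_le _ _).trans_lt hv)
  rwa [Measure.restrict_restrict_of_subset hsub] at this

theorem mutualEnergy_le {s : ℝ} {C : ℝ≥0∞} {B : Set V}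
    (hC : ∀ x, ∫⁻ y in B, rieszKernel s x y ≤ C) (A : Set V) :
    mutualEnergy s A B ≤ C * volume A := by
  calc _ ≤ ∫⁻ _ in A, C := lintegral_mono hC
    _ = _ := by simp

theorem mutualEnergy_ne_top [Nontrivial V] {s : ℝ} (hs : 0 < s) (hs' : s < finrank ℝ V)
    {A B : Set V} (hB : MeasurableSet B) (hA' : volume A ≠ ∞) (hB' : volume B ≠ ∞) :
    mutualEnergy s A B ≠ ∞ := by
  obtain ⟨C, hC, h⟩ := exists_potential_le (V := V) hs hs'
  refine ((mutualEnergy_le (h B · hB) A).trans_lt ?_).ne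
  exact ENNReal.mul_lt_top (by simp [hC.lt_top, hB'.lt_top]) hA'.lt_top


/-- The reflection across the hyperplane `{x | ⟪x, n⟫ = t}`, where `n` is a unit vector. -/
noncomputable def hyperplaneReflection (n : V) (t : ℝ) (x : V) : V :=
  x + (2 * (t - ⟪x, n⟫)) • n

theorem inner_hyperplaneReflection {n : V} (hn : ‖n‖ = 1) (t : ℝ) (x : V) :
    ⟪hyperplaneReflection n t x, n⟫ = 2 * t - ⟪x, n⟫ := by
  rw [hyperplaneReflection, inner_add_left, inner_smul_left, real_inner_self_eq_norm_sq, hn]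
  simp
  ring

theorem hyperplaneReflection_hyperplaneReflection {n : V} (hn : ‖n‖ = 1) (t : ℝ) (x : V) :
    hyperplaneReflection n t (hyperplaneReflection n t x) = x := by
  conv_lhs => rw [hyperplaneReflection, inner_hyperplaneReflection hn, hyperplaneReflection]
  rw [add_assoc, ← add_smul]
  ring_nf
  simp

theorem norm_hyperplaneReflection_sub {n : V} (hn : ‖n‖ = 1) (t : ℝ) (x y : V) :
    ‖hyperplaneReflection n t x - hyperplaneReflection n t y‖ = ‖x - y‖ := by
  rw [← sq_eq_sq₀ (norm_nonneg _) (norm_nonneg _)]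
  have : hyperplaneReflection n t x - hyperplaneReflection n t y =
      (x - y) - (2 * ⟪x - y, n⟫) • n := by
    simp only [hyperplaneReflection, inner_sub_left, mul_sub, sub_smul]
    abel
  rw [this, norm_sub_sq_real, norm_smul, hn, inner_smul_right, Real.norm_eq_abs, mul_one, sq_abs]
  ring

theorem norm_sub_hyperplaneReflection_sq {n : V} (hn : ‖n‖ = 1) (t : ℝ) (x y : V) :
    ‖x - hyperplaneReflection n t y‖ ^ 2 =
      ‖x - y‖ ^ 2 + 4 * (t - ⟪x, n⟫) * (t - ⟪y, n⟫) := by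
  have : x - hyperplaneReflection n t y = (x - y) - (2 * (t - ⟪y, n⟫)) • n := by
    simp only [hyperplaneReflection]
    abel
  rw [this, norm_sub_sq_real, norm_smul, hn, inner_smul_right, Real.norm_eq_abs, mul_one, sq_abs,
    inner_sub_left]
  ring

theorem measurePreserving_hyperplaneReflection {n : V} (hn : ‖n‖ = 1) (t : ℝ) :
    MeasurePreserving (hyperplaneReflection n t) (volume : Measure V) volume := by
  let f : V →ₗᵢ[ℝ] V :=
    { toFun := hyperplaneReflection n 0
      map_add' := fun x y ↦ by
        simp only [hyperplaneReflection, inner_add_left, zero_sub, neg_add, mul_add, add_smul]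
        abel
      map_smul' := fun c x ↦ by
        simp only [hyperplaneReflection, inner_smul_left, zero_sub, smul_add, smul_smul]
        simp only [conj_trivial, RingHom.id_apply]
        ring_nf
      norm_map' := fun x ↦ by
        have := norm_hyperplaneReflection_sub hn 0 x 0
        simpa [hyperplaneReflection] using this }
  have h1 : MeasurePreserving (f.toLinearIsometryEquiv rfl) volume volume :=
    LinearIsometryEquiv.measurePreserving _
  have h2 := (measurePreserving_add_right (volume : Measure V) ((2 * t) • n)).comp h1
  convert h2 using 1
  ext x
  simp only [Function.comp_apply, LinearIsometry.coe_toLinearIsometryEquiv]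
  change _ = hyperplaneReflection n 0 x + _
  simp only [hyperplaneReflection, mul_sub, sub_smul, mul_zero]
  module

/-- The part of `E` in `{⟪x, n⟫ < t}` whose mirror image is outside of `E`. -/
def polarizationFixed (E : Set V) (n : V) (t : ℝ) : Set V :=
  {x | ⟪x, n⟫ < t ∧ x ∈ E ∧ hyperplaneReflection n t x ∉ E}

/-- The part of `Eᶜ` in `{⟪x, n⟫ < t}` whose mirror image is in `E`. -/
def polarizationMoved (E : Set V) (n : V) (t : ℝ) : Set V :=
  {y | ⟪y, n⟫ < t ∧ y ∉ E ∧ hyperplaneReflection n t y ∈ E}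

theorem measurableSet_polarizationFixed {n : V} (hn : ‖n‖ = 1) (t : ℝ) {E : Set V} (hE : MeasurableSet E) :
    MeasurableSet (polarizationFixed E n t) := by
  have h : MeasurableSet {x : V | ⟪x, n⟫ < t} :=
    measurableSet_lt (by fun_prop) measurable_const
  exact h.inter (hE.inter ((measurePreserving_hyperplaneReflection hn t).measurable hE).compl)

theorem measurableSet_polarizationMoved {n : V} (hn : ‖n‖ = 1) (t : ℝ) {E : Set V} (hE : MeasurableSet E) :
    MeasurableSet (polarizationMoved E n t) := by
  have h : MeasurableSet {x : V | ⟪x, n⟫ < t} :=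
    measurableSet_lt (by fun_prop) measurable_const
  exact h.inter (hE.compl.inter ((measurePreserving_hyperplaneReflection hn t).measurable hE))

/-- The decomposition of `E` used in polarization. -/
theorem eq_union_polarization {n : V} (hn : ‖n‖ = 1) (t : ℝ) (E : Set V) :
    E = (E ∩ hyperplaneReflection n t ⁻¹' E ∪ polarizationFixed E n t) ∪
      hyperplaneReflection n t ⁻¹' polarizationMoved E n t := by
  ext x
  simp only [polarizationFixed, polarizationMoved, mem_union, mem_inter_iff, mem_preimage,
    mem_ofPred_eq, inner_hyperplaneReflection hn, hyperplaneReflection_hyperplaneReflection hn]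
  constructor
  · intro hx
    by_cases h : hyperplaneReflection n t x ∈ E
    · exact .inl (.inl ⟨hx, h⟩)
    · rcases lt_trichotomy ⟪x, n⟫ t with h1 | h1 | h1
      · exact .inl (.inr ⟨h1, hx, h⟩)
      · exact absurd (by simpa [hyperplaneReflection, h1] using hx) h
      · exact .inr ⟨by linarith, h, hx⟩
  · tauto

theorem disjoint_polarization {n : V} (hn : ‖n‖ = 1) (t : ℝ) (E : Set V) :
    Disjoint (E ∩ hyperplaneReflection n t ⁻¹' E ∪ polarizationFixed E n t)
      (hyperplaneReflection n t ⁻¹' polarizationMoved E n t) := by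
  rw [Set.disjoint_left]
  rintro x (hx | hx) hx'
  · exact hx'.2.1 hx.2
  · have := hx'.1
    rw [inner_hyperplaneReflection hn] at this
    have := hx.1
    linarith

/-- Polarization increases the Riesz energy, quantitatively. -/
theorem mutualEnergy_add_polarization_le {n : V} (hn : ‖n‖ = 1) (t : ℝ) (s : ℝ) {E : Set V} (hE : MeasurableSet E)
    {M : ℝ≥0∞}
    (hM : ∀ F : Set V, MeasurableSet F → volume F = volume E → mutualEnergy s F F ≤ M)
    (g : V → V → ℝ≥0∞)
    (hg : ∀ x ∈ polarizationFixed E n t, ∀ y ∈ polarizationMoved E n t,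
      rieszKernel s x (hyperplaneReflection n t y) + g x y ≤ rieszKernel s x y) :
    mutualEnergy s E E +
      2 * ∫⁻ x in polarizationFixed E n t, ∫⁻ y in polarizationMoved E n t, g x y ≤ M := by
  set σ := hyperplaneReflection n t with hσ
  set A := polarizationFixed E n t with hAdef
  set B := polarizationMoved E n t with hBdef
  set P := E ∩ σ ⁻¹' E with hPdef
  have hmp := measurePreserving_hyperplaneReflection hn t
  have hA : MeasurableSet A := measurableSet_polarizationFixed hn t hE
  have hB : MeasurableSet B := measurableSet_polarizationMoved hn t hE
  have hB' : MeasurableSet (σ ⁻¹' B) := hmp.measurable hB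
  have hP : MeasurableSet P := hE.inter (hmp.measurable hE)
  have hE_eq : E = (P ∪ A) ∪ σ ⁻¹' B := eq_union_polarization hn t E
  have hd : Disjoint (P ∪ A) (σ ⁻¹' B) := disjoint_polarization hn t E
  have hPA : P ∪ A ⊆ E := by conv_rhs => rw [hE_eq]
                             exact subset_union_left
  have hd' : Disjoint (P ∪ A) B := disjoint_left.2 fun x hx hx' ↦ hx'.2.1 (hPA hx)
  have hPAd : Disjoint P A := disjoint_left.2 fun x hx hx' ↦ hx'.2.2 hx.2
  have hinv : ∀ x, σ (σ x) = x := hyperplaneReflection_hyperplaneReflection hn t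
  have hσP : σ ⁻¹' P = P := by
    ext x
    simp only [hPdef, mem_preimage, mem_inter_iff, hinv]
    tauto
  have hn' := norm_hyperplaneReflection_sub hn t
  have hM' := hM ((P ∪ A) ∪ B) ((hP.union hA).union hB) (by
    conv_rhs => rw [hE_eq]
    rw [measure_union hd' hB, measure_union hd hB', hmp.measure_preimage hB.nullMeasurableSet])
  have h1 : mutualEnergy s (P ∪ A) (σ ⁻¹' B) =
      mutualEnergy s P B + mutualEnergy s A (σ ⁻¹' B) := by
    rw [mutualEnergy_union_left s _ hA hPAd]
    conv_lhs => rw [← hσP]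
    rw [mutualEnergy_preimage s hmp hn' hP hB]
  have h2 : mutualEnergy s (P ∪ A) B = mutualEnergy s P B + mutualEnergy s A B :=
    mutualEnergy_union_left s _ hA hPAd
  have h3 : mutualEnergy s A (σ ⁻¹' B) + ∫⁻ x in A, ∫⁻ y in B, g x y ≤ mutualEnergy s A B := by
    unfold mutualEnergy
    rw [← lintegral_add_left (measurable_potential s _)]
    refine setLIntegral_mono' hA fun x hx ↦ ?_
    have hm : Measurable fun y ↦ rieszKernel s x (σ y) :=
      (measurable_rieszKernel_right s x).comp hmp.measurable
    have : ∫⁻ y in σ ⁻¹' B, rieszKernel s x y = ∫⁻ y in B, rieszKernel s x (σ y) := by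
      rw [← hmp.setLIntegral_comp_preimage hB hm]
      simp only [← hσ, hinv]
    rw [this, ← lintegral_add_left hm]
    exact setLIntegral_mono' hB fun y hy ↦ hg x hx y hy
  have h4 : mutualEnergy s E E = mutualEnergy s (P ∪ A) (P ∪ A) +
      2 * (mutualEnergy s P B + mutualEnergy s A (σ ⁻¹' B)) + mutualEnergy s B B := by
    conv_lhs => rw [hE_eq]
    rw [mutualEnergy_self_union s hB' hd, h1, mutualEnergy_preimage s hmp hn' hB hB]
  rw [mutualEnergy_self_union s hB hd', h2] at hM'
  refine le_trans ?_ hM'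
  rw [h4]
  calc _ = mutualEnergy s (P ∪ A) (P ∪ A) + 2 * (mutualEnergy s P B +
        (mutualEnergy s A (σ ⁻¹' B) + ∫⁻ x in A, ∫⁻ y in B, g x y)) + mutualEnergy s B B := by ring
    _ ≤ _ := by gcongr


/-- A quantitative form of the monotonicity of `a ↦ a ^ (-s)`. -/
theorem rpow_neg_add_le {s a b ρ : ℝ} (hs : 0 < s) (ha : 0 < a) (hab : a ≤ b) (hb : b ≤ ρ) :
    b ^ (-s) + s / 2 * ρ ^ (-s - 2) * (b ^ 2 - a ^ 2) ≤ a ^ (-s) := by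
  have hb0 : 0 < b := ha.trans_le hab
  have h1 : 1 + s / 2 * (1 - (a / b) ^ 2) ≤ (a / b) ^ (-s) := by
    have hx : 0 < a / b := div_pos ha hb0
    have h2 := Real.log_le_sub_one_of_pos (pow_pos hx 2)
    rw [Real.log_pow] at h2
    rw [Real.rpow_def_of_pos hx]
    have h3 := Real.add_one_le_exp (Real.log (a / b) * -s)
    push_cast at h2
    nlinarith
  have h2 : a ^ (-s) = b ^ (-s) * (a / b) ^ (-s) := by
    rw [← Real.mul_rpow hb0.le (by positivity), mul_div_cancel₀ _ hb0.ne']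
  have h3 : ρ ^ (-s - 2) ≤ b ^ (-s - 2) :=
    Real.rpow_le_rpow_of_nonpos hb0 hb (by linarith)
  have h4 : b ^ (-s) * (1 - (a / b) ^ 2) = b ^ (-s - 2) * (b ^ 2 - a ^ 2) := by
    rw [Real.rpow_sub hb0, Real.rpow_two]
    field_simp
  have h5 : 0 ≤ b ^ 2 - a ^ 2 := by nlinarith
  have h6 : 0 < b ^ (-s) := by positivity
  calc b ^ (-s) + s / 2 * ρ ^ (-s - 2) * (b ^ 2 - a ^ 2)
      ≤ b ^ (-s) + s / 2 * (b ^ (-s - 2) * (b ^ 2 - a ^ 2)) := by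
        rw [mul_assoc]; gcongr
    _ = b ^ (-s) * (1 + s / 2 * (1 - (a / b) ^ 2)) := by rw [← h4]; ring
    _ ≤ _ := by rw [h2]; gcongr

theorem hyperplaneReflection_moment {n : V} (hn : ‖n‖ = 1) (t : ℝ) {F : Set V}
    (hF : MeasurableSet F) (hFi : IntegrableOn (fun x ↦ x) F) (hFv : volume F ≠ ∞)
    (hF0 : ∫ x in F, x = 0) :
    IntegrableOn (fun x ↦ t - ⟪x, n⟫) (polarizationFixed F n t) ∧
    IntegrableOn (fun x ↦ t - ⟪x, n⟫) (polarizationMoved F n t) ∧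
    ∫ x in polarizationFixed F n t, (t - ⟪x, n⟫) =
      t * volume.real F + ∫ x in polarizationMoved F n t, (t - ⟪x, n⟫) := by
  set σ := hyperplaneReflection n t with hσ
  set A := polarizationFixed F n t with hAdef
  set B := polarizationMoved F n t with hBdef
  set P := F ∩ σ ⁻¹' F with hPdef
  have hmp : MeasurePreserving σ volume volume := measurePreserving_hyperplaneReflection hn t
  have hA : MeasurableSet A := measurableSet_polarizationFixed hn t hF
  have hB : MeasurableSet B := measurableSet_polarizationMoved hn t hF
  have hB' : MeasurableSet (σ ⁻¹' B) := hmp.measurable hB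
  have hF_eq : F = (P ∪ A) ∪ σ ⁻¹' B := eq_union_polarization hn t F
  have hd : Disjoint (P ∪ A) (σ ⁻¹' B) := disjoint_polarization hn t F
  have hPAd : Disjoint P A := disjoint_left.2 fun x hx hx' ↦ hx'.2.2 hx.2
  have hinv : ∀ x, σ (σ x) = x := hyperplaneReflection_hyperplaneReflection hn t
  have hσP : σ ⁻¹' P = P := by
    ext x
    simp only [hPdef, mem_preimage, mem_inter_iff, hinv]
    tauto
  have hemb : MeasurableEmbedding σ :=
    (MeasurableEquiv.mk (Equiv.mk σ σ hinv hinv) hmp.measurable hmp.measurable).measurableEmbedding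
  have hanti : ∀ x, t - ⟪σ x, n⟫ = -(t - ⟪x, n⟫) := fun x ↦ by
    rw [hσ, inner_hyperplaneReflection hn]; ring
  have hinner : IntegrableOn (fun x : V ↦ ⟪x, n⟫) F := hFi.inner_const n
  have hinteg : IntegrableOn (fun x : V ↦ t - ⟪x, n⟫) F :=
    (integrableOn_const hFv).sub hinner
  have hA_sub : A ⊆ F := fun x hx ↦ hx.2.1
  have hP_sub : P ⊆ F := fun x hx ↦ hx.1
  have hB_sub : σ ⁻¹' B ⊆ F := fun x hx ↦ by simpa [hinv] using (show σ (σ x) ∈ F from hx.2.2)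
  have hcompl : ∀ S : Set V, MeasurableSet S →
      ∫ x in σ ⁻¹' S, (t - ⟪x, n⟫) = -∫ x in S, (t - ⟪x, n⟫) := by
    intro S hS
    rw [← hmp.setIntegral_preimage_emb hemb (fun x ↦ t - ⟪x, n⟫) S, ← integral_neg]
    simp only [hanti, neg_neg]
  have hBi : IntegrableOn (fun x ↦ t - ⟪x, n⟫) B := by
    rw [← hmp.integrableOn_comp_preimage hemb]
    refine ((hinteg.mono_set hB_sub).neg).congr_fun (fun x _ ↦ ?_) hB'
    simp [hanti]
  refine ⟨hinteg.mono_set hA_sub, hBi, ?_⟩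
  have h0 : ∫ x in P, (t - ⟪x, n⟫) = 0 := by
    have := hcompl P (hF.inter (hmp.measurable hF))
    rw [hσP] at this
    linarith
  have h1 : ∫ x in F, (t - ⟪x, n⟫) = t * volume.real F := by
    have hconst : IntegrableOn (fun _ : V ↦ t) F := integrableOn_const hFv
    rw [integral_sub hconst hinner]
    have h2 : ∫ x in F, ⟪x, n⟫ = 0 := by
      have := integral_inner (𝕜 := ℝ) hFi n
      simp only [real_inner_comm] at this ⊢
      rw [hF0] at this
      simpa using this
    rw [h2]
    simp [Measure.real, mul_comm]
  have h3 : ∫ x in F, (t - ⟪x, n⟫) =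
      (∫ x in P, (t - ⟪x, n⟫)) + (∫ x in A, (t - ⟪x, n⟫)) + ∫ x in σ ⁻¹' B, (t - ⟪x, n⟫) := by
    conv_lhs => rw [hF_eq]
    rw [setIntegral_union hd hB' _ (hinteg.mono_set hB_sub), setIntegral_union hPAd hA
      (hinteg.mono_set hP_sub) (hinteg.mono_set hA_sub)]
    exact hinteg.mono_set (union_subset hP_sub hA_sub)
  rw [hcompl B hB, h0, h1] at h3
  linarith

/-- Polarization of an almost maximizer with barycenter `0` moves little mass. -/
theorem moved_moment_le [Nontrivial V] {s R D : ℝ} (hs : 0 < s) (hs' : s < finrank ℝ V)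
    (hR : 0 < R) (hD : 0 ≤ D) {F : Set V}
    (hF : MeasurableSet F) (hFR : F ⊆ ball 0 R) (hF0 : ∫ x in F, x = 0)
    (hmax : ∀ F' : Set V, MeasurableSet F' → volume F' = volume F →
      mutualEnergy s F' F' ≤ mutualEnergy s F F + ENNReal.ofReal D)
    {n : V} (hn : ‖n‖ = 1) {t : ℝ} (ht : 0 < t) :
    ∃ β : ℝ, 0 ≤ β ∧
      ∫⁻ y in polarizationMoved F n t, ENNReal.ofReal (t - ⟪y, n⟫) = ENNReal.ofReal β ∧
      4 * s * (2 * R) ^ (-s - 2) * (β * (β + t * volume.real F)) ≤ D := by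
  set A := polarizationFixed F n t with hAdef
  set B := polarizationMoved F n t with hBdef
  have hA : MeasurableSet A := measurableSet_polarizationFixed hn t hF
  have hB : MeasurableSet B := measurableSet_polarizationMoved hn t hF
  have hFv : volume F ≠ ∞ := ((measure_mono hFR).trans_lt measure_ball_lt_top).ne
  have hFi : IntegrableOn (fun x : V ↦ x) F :=
    (continuous_id.continuousOn.integrableOn_compact (isCompact_closedBall (0 : V) R)).mono_set
      (hFR.trans ball_subset_closedBall)
  obtain ⟨hAi, hBi, hm⟩ := hyperplaneReflection_moment hn t hF hFi hFv hF0
  set c := s / 2 * (2 * R) ^ (-s - 2) * 4 with hc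
  have hc0 : 0 ≤ c := by positivity
  have key := mutualEnergy_add_polarization_le hn t s hF hmax
    (fun x y ↦ ENNReal.ofReal c * (ENNReal.ofReal (t - ⟪x, n⟫) * ENNReal.ofReal (t - ⟪y, n⟫))) (by
    intro x hx y hy
    have hxy : 0 < ‖x - y‖ := norm_pos_iff.2 (sub_ne_zero.2 fun h ↦ hy.2.1 (h ▸ hx.2.1))
    have h1 := norm_sub_hyperplaneReflection_sq hn t x y
    have hdx : 0 < t - ⟪x, n⟫ := sub_pos.2 hx.1
    have hdy : 0 < t - ⟪y, n⟫ := sub_pos.2 hy.1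
    have hle : ‖x - y‖ ≤ ‖x - hyperplaneReflection n t y‖ := by
      rw [← sq_le_sq₀ (norm_nonneg _) (norm_nonneg _), h1]
      nlinarith [mul_pos hdx hdy]
    have hb : ‖x - hyperplaneReflection n t y‖ ≤ 2 * R := by
      have h2 := hFR hx.2.1
      have h3 := hFR hy.2.2
      rw [mem_ball_zero_iff] at h2 h3
      linarith [norm_sub_le x (hyperplaneReflection n t y)]
    have h4 := rpow_neg_add_le hs hxy hle hb
    unfold rieszKernel
    rw [← ENNReal.ofReal_mul hdx.le, ← ENNReal.ofReal_mul hc0, ← ENNReal.ofReal_add (by positivity)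
      (by positivity)]
    refine ENNReal.ofReal_le_ofReal ?_
    rw [h1] at h4
    refine le_trans (le_of_eq ?_) h4
    rw [hc]; ring)
  have hmE : mutualEnergy s F F ≠ ∞ := mutualEnergy_ne_top hs hs' hF hFv hFv
  rw [ENNReal.add_le_add_iff_left hmE] at key
  have hmeas : Measurable fun y : V ↦ ENNReal.ofReal (t - ⟪y, n⟫) := by fun_prop
  have e1 : ∀ x : V, ∫⁻ y in B, ENNReal.ofReal c * (ENNReal.ofReal (t - ⟪x, n⟫) *
      ENNReal.ofReal (t - ⟪y, n⟫)) = ENNReal.ofReal c * (ENNReal.ofReal (t - ⟪x, n⟫) *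
      ∫⁻ y in B, ENNReal.ofReal (t - ⟪y, n⟫)) := by
    intro x
    rw [lintegral_const_mul _ (by fun_prop), lintegral_const_mul _ hmeas]
  simp_rw [← hAdef, ← hBdef, e1] at key
  rw [lintegral_const_mul _ (by fun_prop), lintegral_mul_const _ hmeas] at key
  have eA : ∫⁻ y in A, ENNReal.ofReal (t - ⟪y, n⟫) = ENNReal.ofReal (∫ y in A, (t - ⟪y, n⟫)) :=
    (ofReal_integral_eq_lintegral_ofReal hAi
      ((ae_restrict_iff' hA).2 (.of_forall fun x hx ↦ (sub_pos.2 hx.1).le))).symm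
  have eB : ∫⁻ y in B, ENNReal.ofReal (t - ⟪y, n⟫) = ENNReal.ofReal (∫ y in B, (t - ⟪y, n⟫)) :=
    (ofReal_integral_eq_lintegral_ofReal hBi
      ((ae_restrict_iff' hB).2 (.of_forall fun x hx ↦ (sub_pos.2 hx.1).le))).symm
  have hβ : 0 ≤ ∫ y in B, (t - ⟪y, n⟫) :=
    setIntegral_nonneg hB fun x hx ↦ (sub_pos.2 hx.1).le
  refine ⟨∫ y in B, (t - ⟪y, n⟫), hβ, eB, ?_⟩
  rw [eA, eB, hm, ← ENNReal.ofReal_mul (by positivity), ← ENNReal.ofReal_mul hc0,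
    ← ENNReal.ofReal_ofNat, ← ENNReal.ofReal_mul (by norm_num), ENNReal.ofReal_le_ofReal_iff hD]
    at key
  refine le_trans (le_of_eq ?_) key
  rw [hc]; ring

theorem lintegral_polar [Nontrivial V] {f : V → ℝ≥0∞} (hf : Measurable f) :
    ∫⁻ x, f x = ∫⁻ n, (∫⁻ ρ in Ioi (0 : ℝ),
      ENNReal.ofReal (ρ ^ (finrank ℝ V - 1)) * f (ρ • (n : V)))
        ∂(volume : Measure V).toSphere := by
  have h0 : ∫⁻ x, f x = ∫⁻ x : ({0}ᶜ : Set V), f x ∂((volume : Measure V).comap (↑)) := by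
    rw [lintegral_subtype_comap (measurableSet_singleton _).compl, restrict_compl_singleton]
  have hmp := (volume : Measure V).measurePreserving_homeomorphUnitSphereProd
  have h1 : ∀ x : ({0}ᶜ : Set V), (x : V) = (((homeomorphUnitSphereProd V).symm
      (homeomorphUnitSphereProd V x) : ({0}ᶜ : Set V)) : V) := fun x ↦ by simp
  have hm : Measurable fun p : sphere (0 : V) 1 × Ioi (0 : ℝ) ↦
      f (((homeomorphUnitSphereProd V).symm p : ({0}ᶜ : Set V)) : V) :=
    hf.comp (measurable_subtype_coe.comp (homeomorphUnitSphereProd V).symm.measurable)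
  rw [h0, lintegral_congr fun x ↦ congrArg f (h1 x), hmp.lintegral_comp hm, lintegral_prod _ hm.aemeasurable]
  refine lintegral_congr fun n ↦ ?_
  have hm2 : Measurable fun r : Ioi (0 : ℝ) ↦ f (r.1 • (n : V)) := by fun_prop
  simp only [homeomorphUnitSphereProd_symm_apply_coe]
  rw [Measure.volumeIoiPow, lintegral_withDensity_eq_lintegral_mul _ (by fun_prop) hm2]
  simp only [Pi.mul_apply]
  exact lintegral_subtype_comap measurableSet_Ioi
    (fun ρ : ℝ ↦ ENNReal.ofReal (ρ ^ (finrank ℝ V - 1)) * f (ρ • (n : V)))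

theorem lintegral_comp_add_half {f : ℝ → ℝ≥0∞} (hf : Measurable f) (a : ℝ) :
    ∫⁻ ρ, f (a + ρ / 2) = 2 * ∫⁻ t, f t := by
  have hm : Measurable fun x ↦ f (a + x) := by fun_prop
  have h := lintegral_preimage_smul (V := ℝ) (r := 1 / 2) (by norm_num) MeasurableSet.univ hm
  simp only [preimage_univ, Measure.restrict_univ, finrank_self, pow_one, smul_eq_mul] at h
  rw [lintegral_add_left_eq_self] at h
  simp only [div_eq_inv_mul] at h ⊢
  rw [mul_one] at h
  rw [h]
  norm_num

/-- Integrating the moments of the moved parts over all hyperplanes. -/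
theorem lintegral_lintegral_le_moved_moments [Nontrivial V] (hN : 2 ≤ finrank ℝ V) {R : ℝ}
    (hR : 0 < R)
    {F : Set V} (hF : MeasurableSet F) (hFR : F ⊆ ball 0 R) {ψ B : ℝ → ℝ≥0∞} (hψ : Measurable ψ)
    (hB : ∀ n : V, ‖n‖ = 1 → ∀ t : ℝ, 0 < t →
      ∫⁻ y in polarizationMoved F n t, ENNReal.ofReal (t - ⟪y, n⟫) ≤ B t) :
    ∫⁻ y in Fᶜ, ∫⁻ z in F ∩ {z | ‖y‖ < ‖z‖},
        ψ ((‖z‖ ^ 2 - ‖y‖ ^ 2) / (2 * ‖z - y‖)) ≤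
      ENNReal.ofReal (4 * (2 * R) ^ (finrank ℝ V - 2)) * (volume : Measure V).toSphere univ *
        ∫⁻ t in Ioi 0, ψ t * B t := by
  obtain ⟨k, hk⟩ : ∃ k, finrank ℝ V = k + 2 := ⟨_, (Nat.sub_add_cancel hN).symm⟩
  set S : Set (V × V) := {p | p.1 ∉ F ∧ p.2 ∈ F ∧ ‖p.1‖ < ‖p.2‖} with hSdef
  have hS : MeasurableSet S := by
    have h1 : MeasurableSet {p : V × V | ‖p.1‖ < ‖p.2‖} :=
      measurableSet_lt (by fun_prop) (by fun_prop)
    exact (measurable_fst hF).compl.inter ((measurable_snd hF).inter h1)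
  set H : V × V → ℝ≥0∞ :=
    S.indicator fun p ↦ ψ ((‖p.2‖ ^ 2 - ‖p.1‖ ^ 2) / (2 * ‖p.2 - p.1‖)) with hHdef
  have hH : Measurable H := (hψ.comp (by fun_prop)).indicator hS
  have e1 : ∫⁻ y in Fᶜ, ∫⁻ z in F ∩ {z | ‖y‖ < ‖z‖},
      ψ ((‖z‖ ^ 2 - ‖y‖ ^ 2) / (2 * ‖z - y‖)) = ∫⁻ y, ∫⁻ z, H (y, z) := by
    rw [← lintegral_indicator hF.compl]
    refine lintegral_congr fun y ↦ ?_
    have hm : MeasurableSet (F ∩ {z | ‖y‖ < ‖z‖}) :=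
      hF.inter (measurableSet_lt measurable_const measurable_norm)
    by_cases hy : y ∈ F
    · simp [hHdef, hSdef, hy]
    · rw [indicator_of_mem (by exact hy), ← lintegral_indicator hm]
      refine lintegral_congr fun z ↦ ?_
      classical
      simp only [hHdef, hSdef, indicator_apply, mem_inter_iff, mem_ofPred_eq, hy,
        not_false_eq_true, true_and]
  rw [e1]
  have e2 : ∀ y : V, ∫⁻ z, H (y, z) = ∫⁻ n, (∫⁻ ρ in Ioi (0 : ℝ),
      ENNReal.ofReal (ρ ^ (k + 1)) * H (y, y + ρ • (n : V))) ∂(volume : Measure V).toSphere := by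
    intro y
    rw [← lintegral_add_left_eq_self (fun z ↦ H (y, z)) y, lintegral_polar (by fun_prop), hk]
    rfl
  simp_rw [e2]
  rw [lintegral_lintegral_swap]
  swap
  · refine Measurable.aemeasurable ?_
    have : Measurable fun p : (V × sphere (0 : V) 1) × ℝ ↦
      ENNReal.ofReal (p.2 ^ (k + 1)) * H (p.1.1, p.1.1 + p.2 • (p.1.2 : V)) := by fun_prop
    exact this.lintegral_prod_right'
  have key : ∀ n : sphere (0 : V) 1, ∫⁻ y : V, ∫⁻ ρ in Ioi (0 : ℝ),
      ENNReal.ofReal (ρ ^ (k + 1)) * H (y, y + ρ • (n : V)) ≤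
      ENNReal.ofReal (4 * (2 * R) ^ k) * ∫⁻ t in Ioi 0, ψ t * B t := by
    rintro ⟨n, hn⟩
    rw [mem_sphere_zero_iff_norm] at hn
    set T : Set (V × ℝ) := {p | ⟪p.1, n⟫ < p.2 ∧ p.1 ∉ F ∧ hyperplaneReflection n p.2 p.1 ∈ F ∧
      0 < p.2} with hTdef
    have hT : MeasurableSet T := by
      have h1 : MeasurableSet {p : V × ℝ | ⟪p.1, n⟫ < p.2} :=
        measurableSet_lt (by fun_prop) (by fun_prop)
      have h2 : MeasurableSet {p : V × ℝ | 0 < p.2} :=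
        measurableSet_lt (by fun_prop) (by fun_prop)
      have h3 : Measurable fun p : V × ℝ ↦ hyperplaneReflection n p.2 p.1 := by
        unfold hyperplaneReflection
        fun_prop
      exact h1.inter ((measurable_fst hF).compl.inter ((h3 hF).inter h2))
    set G : V × ℝ → ℝ≥0∞ := T.indicator fun p ↦ ψ p.2 * ENNReal.ofReal (p.2 - ⟪p.1, n⟫) with hGdef
    have hG : Measurable G := by
      refine Measurable.indicator ?_ hT
      exact (hψ.comp measurable_snd).mul (by fun_prop)
    have hpt : ∀ y : V, ∀ ρ ∈ Ioi (0 : ℝ), ENNReal.ofReal (ρ ^ (k + 1)) * H (y, y + ρ • n) ≤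
        ENNReal.ofReal (2 * (2 * R) ^ k) * G (y, ⟪y, n⟫ + ρ / 2) := by
      intro y ρ hρ
      rw [mem_Ioi] at hρ
      by_cases h : (y, y + ρ • n) ∈ S
      · have hnorm : ‖y + ρ • n‖ ^ 2 = ‖y‖ ^ 2 + 2 * (ρ * ⟪y, n⟫) + ρ ^ 2 := by
          rw [norm_add_sq_real, inner_smul_right, norm_smul, hn, mul_one, Real.norm_eq_abs, sq_abs]
        have hlt : ‖y‖ ^ 2 < ‖y + ρ • n‖ ^ 2 := by
          have := h.2.2
          gcongr
        have ht : 0 < ⟪y, n⟫ + ρ / 2 := by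
          rw [hnorm] at hlt
          have : 0 < ρ * (⟪y, n⟫ + ρ / 2) := by nlinarith
          exact pos_of_mul_pos_right this hρ.le
        have hρR : ρ ≤ 2 * R := by
          have h1 := hFR h.2.1
          have h2 := h.2.2
          rw [mem_ball_zero_iff] at h1
          have h3 : ‖ρ • n‖ = ρ := by rw [norm_smul, hn, mul_one, Real.norm_of_nonneg hρ.le]
          have h4 : ‖ρ • n‖ ≤ ‖y + ρ • n‖ + ‖y‖ := by
            have := norm_sub_le (y + ρ • n) y
            rwa [add_sub_cancel_left] at this
          simp only at h2
          linarith
        have hmem : (y, ⟪y, n⟫ + ρ / 2) ∈ T := by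
          refine ⟨?_, h.1, ?_, ht⟩
          · simp only; linarith
          · simp only [hyperplaneReflection, add_sub_cancel_left]
            rw [mul_div_cancel₀ _ (two_ne_zero' ℝ)]
            exact h.2.1
        rw [hHdef, hGdef, indicator_of_mem h, indicator_of_mem hmem]
        simp only [add_sub_cancel_left]
        have e : (‖y + ρ • n‖ ^ 2 - ‖y‖ ^ 2) / (2 * ‖ρ • n‖) = ⟪y, n⟫ + ρ / 2 := by
          rw [hnorm, norm_smul, hn, mul_one, Real.norm_of_nonneg hρ.le]
          field_simp
          ring
        rw [e, mul_left_comm, mul_comm]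
        have : ENNReal.ofReal (ρ ^ (k + 1)) ≤
            ENNReal.ofReal (2 * (2 * R) ^ k) * ENNReal.ofReal (ρ / 2) := by
          rw [← ENNReal.ofReal_mul (by positivity)]
          refine ENNReal.ofReal_le_ofReal ?_
          rw [pow_succ]
          have : ρ ^ k ≤ (2 * R) ^ k := by gcongr
          nlinarith
        rw [mul_comm]
        exact le_trans (by rw [mul_comm]) (mul_le_mul_right this _)
      · rw [hHdef, indicator_of_notMem h, mul_zero]
        exact zero_le
    calc ∫⁻ y : V, ∫⁻ ρ in Ioi (0 : ℝ), ENNReal.ofReal (ρ ^ (k + 1)) * H (y, y + ρ • n)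
        ≤ ∫⁻ y : V, ∫⁻ ρ, ENNReal.ofReal (2 * (2 * R) ^ k) * G (y, ⟪y, n⟫ + ρ / 2) := by
          refine lintegral_mono fun y ↦ ?_
          exact (setLIntegral_mono' measurableSet_Ioi (hpt y)).trans (setLIntegral_le_lintegral _ _)
      _ = ∫⁻ y : V, ENNReal.ofReal (4 * (2 * R) ^ k) * ∫⁻ t, G (y, t) := by
          refine lintegral_congr fun y ↦ ?_
          rw [lintegral_const_mul _ (by fun_prop),
            lintegral_comp_add_half (f := fun t ↦ G (y, t)) (by fun_prop), ← mul_assoc]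
          congr 1
          rw [← ENNReal.ofReal_ofNat 2, ← ENNReal.ofReal_mul (by positivity)]
          congr 1
          ring
      _ = ENNReal.ofReal (4 * (2 * R) ^ k) * ∫⁻ t, ∫⁻ y : V, G (y, t) := by
          rw [lintegral_const_mul _ hG.lintegral_prod_right', lintegral_lintegral_swap]
          exact hG.aemeasurable
      _ ≤ _ := by
          refine mul_le_mul_right ?_ _
          rw [← lintegral_indicator measurableSet_Ioi]
          refine lintegral_mono fun t ↦ ?_
          by_cases ht : 0 < t
          · rw [indicator_of_mem (by exact ht)]
            refine le_trans (le_of_eq ?_) (mul_le_mul_right (hB n hn t ht) (ψ t))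
            rw [← lintegral_const_mul _ (by fun_prop),
              ← lintegral_indicator (measurableSet_polarizationMoved hn t hF)]
            refine lintegral_congr fun y ↦ ?_
            classical
            simp only [hGdef, hTdef, indicator_apply, mem_ofPred_eq, polarizationMoved, ht,
              and_true]
          · have : ∀ y : V, G (y, t) = 0 := fun y ↦
              indicator_of_notMem (fun h ↦ ht h.2.2.2) _
            simp [this]
  calc _ ≤ ∫⁻ n, (ENNReal.ofReal (4 * (2 * R) ^ k) * ∫⁻ t in Ioi 0, ψ t * B t)
        ∂(volume : Measure V).toSphere := lintegral_mono key
    _ = _ := by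
      rw [lintegral_const, hk, Nat.add_sub_cancel]
      ring

theorem lintegral_inv_sq_Ioi {m : ℝ} (hm : 0 < m) :
    ∫⁻ t in Ioi m, ENNReal.ofReal ((t ^ 2)⁻¹) = ENNReal.ofReal m⁻¹ := by
  have h1 := integrableOn_Ioi_rpow_of_lt (a := -2) (by norm_num) hm
  have h2 := integral_Ioi_rpow_of_lt (a := -2) (by norm_num) hm
  have h3 : ∀ t ∈ Ioi m, ENNReal.ofReal ((t ^ 2)⁻¹) = ENNReal.ofReal (t ^ (-2 : ℝ)) := by
    intro t ht
    rw [Real.rpow_neg (hm.trans ht).le, Real.rpow_two]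
  rw [setLIntegral_congr_fun measurableSet_Ioi h3, ← ofReal_integral_eq_lintegral_ofReal h1, h2]
  · congr 1
    norm_num [Real.rpow_neg_one]
  · exact (ae_restrict_iff' measurableSet_Ioi).2
      (.of_forall fun t ht ↦ Real.rpow_nonneg (hm.trans ht).le _)

/-- An upper bound for the amount of mass of an almost maximizer that can be moved inwards. -/
theorem exists_lintegral_lintegral_le [Nontrivial V] (hN : 2 ≤ finrank ℝ V) {s R v : ℝ}
    (hs : 0 < s) (hs' : s < finrank ℝ V) (hR : 0 < R) (hv : 0 < v) :
    ∃ K : ℝ, 0 < K ∧ ∀ (D : ℝ) (F : Set V), 0 ≤ D → MeasurableSet F → F ⊆ ball 0 R →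
      ∫ x in F, x = 0 → v ≤ volume.real F →
      (∀ F' : Set V, MeasurableSet F' → volume F' = volume F →
        mutualEnergy s F' F' ≤ mutualEnergy s F F + ENNReal.ofReal D) →
      ∀ m : ℝ, 0 < m → ∫⁻ y in Fᶜ, ∫⁻ z in F ∩ {z | ‖y‖ < ‖z‖},
        ENNReal.ofReal (max ((‖z‖ ^ 2 - ‖y‖ ^ 2) / (2 * ‖z - y‖)) m)⁻¹ ≤
          ENNReal.ofReal (K * (√D + D / m)) := by
  set c := 4 * s * (2 * R) ^ (-s - 2) with hc
  have hc0 : 0 < c := by positivity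
  set T := (volume : Measure V).toSphere.real univ with hT
  set A := 4 * (2 * R) ^ (finrank ℝ V - 2) * T with hA
  have hA0 : 0 ≤ A := by positivity
  refine ⟨A * ((√c)⁻¹ + (c * v)⁻¹) + 1, by positivity, fun D F hD hF hFR hF0 hFv hmax m hm ↦ ?_⟩
  set B : ℝ → ℝ≥0∞ := fun t ↦ ENNReal.ofReal (min (√D / √c) (D / (c * v) * t⁻¹)) with hB
  have key := lintegral_lintegral_le_moved_moments hN hR hF hFR
    (ψ := fun t ↦ ENNReal.ofReal (max t m)⁻¹) (B := B) (by fun_prop) (by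
    intro n hn t ht
    obtain ⟨β, hβ0, hβ, hβD⟩ := moved_moment_le hs hs' hR hD hF hFR hF0 hmax hn ht
    rw [hβ]
    have h0 : 0 ≤ β * (t * volume.real F) := by positivity
    refine ENNReal.ofReal_le_ofReal (le_min ?_ ?_)
    · rw [← Real.sqrt_div hD]
      refine Real.le_sqrt_of_sq_le ?_
      rw [le_div_iff₀ hc0]
      nlinarith
    · rw [← div_eq_mul_inv, div_div, le_div_iff₀ (by positivity)]
      have h1 : β * (t * v) ≤ β * (t * volume.real F) := by gcongr
      nlinarith [sq_nonneg β])
  refine key.trans ?_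
  have hT' : (volume : Measure V).toSphere univ = ENNReal.ofReal T := by
    rw [hT, ofReal_measureReal]
  rw [hT', ← ENNReal.ofReal_mul (by positivity)]
  have hsplit : Ioi (0 : ℝ) = Ioc 0 m ∪ Ioi m := (Ioc_union_Ioi_eq_Ioi hm.le).symm
  have h1 : ∫⁻ t in Ioc 0 m, ENNReal.ofReal (max t m)⁻¹ * B t ≤ ENNReal.ofReal (√D / √c) := by
    calc _ ≤ ∫⁻ t in Ioc 0 m, ENNReal.ofReal (m⁻¹ * (√D / √c)) := by
          refine setLIntegral_mono' measurableSet_Ioc fun t ht ↦ ?_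
          rw [hB, ← ENNReal.ofReal_mul (by positivity)]
          refine ENNReal.ofReal_le_ofReal ?_
          rw [max_eq_right ht.2]
          gcongr
          exact min_le_left _ _
      _ = _ := by
          rw [setLIntegral_const, Real.volume_Ioc, sub_zero, ← ENNReal.ofReal_mul (by positivity)]
          congr 1
          field_simp
  have h2 : ∫⁻ t in Ioi m, ENNReal.ofReal (max t m)⁻¹ * B t ≤
      ENNReal.ofReal (D / (c * v) * m⁻¹) := by
    calc _ ≤ ∫⁻ t in Ioi m, ENNReal.ofReal (D / (c * v)) * ENNReal.ofReal ((t ^ 2)⁻¹) := by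
          refine setLIntegral_mono' measurableSet_Ioi fun t ht ↦ ?_
          have ht0 : 0 < t := hm.trans ht
          rw [hB, ← ENNReal.ofReal_mul (by positivity), ← ENNReal.ofReal_mul (by positivity)]
          refine ENNReal.ofReal_le_ofReal ?_
          rw [max_eq_left (le_of_lt ht)]
          calc _ ≤ t⁻¹ * (D / (c * v) * t⁻¹) := by
                gcongr
                exact min_le_right _ _
            _ = _ := by rw [sq, mul_inv]; ring
      _ = _ := by
          rw [lintegral_const_mul _ (by fun_prop), lintegral_inv_sq_Ioi hm,
            ← ENNReal.ofReal_mul (by positivity)]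
  rw [hsplit, lintegral_union measurableSet_Ioi
    (disjoint_left.2 fun x hx hx' ↦ (not_lt.2 hx.2) hx')]
  refine (mul_le_mul_right (add_le_add h1 h2) _).trans ?_
  rw [← ENNReal.ofReal_add (by positivity) (by positivity), ← ENNReal.ofReal_mul (by positivity)]
  refine ENNReal.ofReal_le_ofReal ?_
  have e1 : √D / √c = √D * (√c)⁻¹ := div_eq_mul_inv _ _
  have e2 : D / (c * v) * m⁻¹ = D / m * (c * v)⁻¹ := by
    rw [div_eq_mul_inv, div_eq_mul_inv]; ring
  rw [e1, e2]
  have p1 : 0 ≤ D / m := by positivity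
  have p2 : 0 ≤ √D := by positivity
  have p3 : 0 ≤ (√c)⁻¹ := by positivity
  have p4 : 0 ≤ (c * v)⁻¹ := by positivity
  have : √D * (√c)⁻¹ + D / m * (c * v)⁻¹ ≤ ((√c)⁻¹ + (c * v)⁻¹) * (√D + D / m) := by
    nlinarith [mul_nonneg p1 p3, mul_nonneg p2 p4]
  nlinarith [mul_le_mul_of_nonneg_left this hA0]

/-- The points whose direction is close to `u`. -/
def coneAround (u : V) (k : ℕ) : Set V :=
  {x | ‖x - ‖x‖ • u‖ ≤ ‖x‖ / k}

theorem measurableSet_coneAround (u : V) (k : ℕ) : MeasurableSet (coneAround u k) :=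
  measurableSet_le (by fun_prop) (by fun_prop)

theorem volume_real_coneAround_inter_ball_one (hN : 2 ≤ finrank ℝ V) {u : V} (hu : ‖u‖ ≤ 1)
    {k : ℕ} (hk : 2 ≤ k) :
    volume.real (coneAround u k ∩ ball (0 : V) 1) ≤ 4 / k * volume.real (ball (0 : V) 1) := by
  have hk0 : (0 : ℝ) < k := by positivity
  have hsub : coneAround u k ∩ ball (0 : V) 1 ⊆
      ⋃ j ∈ Finset.range k, closedBall ((j / k : ℝ) • u) (2 / k) := by
    rintro x ⟨hx, hx1⟩
    rw [mem_ball_zero_iff] at hx1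
    have h0 : 0 ≤ k * ‖x‖ := by positivity
    have hj1 := Nat.floor_le h0
    have hj2 := Nat.lt_floor_add_one (k * ‖x‖)
    set j := ⌊k * ‖x‖⌋₊
    simp only [mem_iUnion, Finset.mem_range, mem_closedBall, dist_eq_norm]
    refine ⟨j, ?_, ?_⟩
    · have : (j : ℝ) < k := by nlinarith
      exact_mod_cast this
    · have e : x - (j / k : ℝ) • u = (x - ‖x‖ • u) + (‖x‖ - j / k) • u := by
        rw [sub_smul]; abel
      have h1 : ‖(‖x‖ - j / k) • u‖ ≤ 1 / k := by
        rw [norm_smul, Real.norm_eq_abs]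
        have : |‖x‖ - j / k| ≤ 1 / k := by
          rw [abs_le]
          constructor
          · have : (j : ℝ) / k ≤ ‖x‖ := by rw [div_le_iff₀ hk0]; linarith
            have : (0 : ℝ) ≤ 1 / k := by positivity
            linarith
          · rw [sub_le_iff_le_add, ← add_div, le_div_iff₀ hk0]; linarith
        calc _ ≤ 1 / (k : ℝ) * 1 := by gcongr
          _ = _ := mul_one _
      have h2 : ‖x - ‖x‖ • u‖ ≤ 1 / k := by
        refine le_trans hx ?_
        gcongr
      rw [e]
      refine (norm_add_le _ _).trans ?_
      calc _ ≤ (1 : ℝ) / k + 1 / k := add_le_add h2 h1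
        _ = _ := by ring
  have hfin : volume (⋃ j ∈ Finset.range k, closedBall ((j / k : ℝ) • u) (2 / k)) ≠ ∞ :=
    ((measure_biUnion_finset_le _ _).trans_lt
      (ENNReal.sum_lt_top.2 fun _ _ ↦ measure_closedBall_lt_top)).ne
  calc _ ≤ volume.real (⋃ j ∈ Finset.range k, closedBall ((j / k : ℝ) • u) (2 / k)) :=
        measureReal_mono hsub hfin
    _ ≤ ∑ j ∈ Finset.range k, volume.real (closedBall ((j / k : ℝ) • u) (2 / k)) :=
        measureReal_biUnion_finset_le _ _
    _ = k * ((2 / k) ^ finrank ℝ V * volume.real (ball (0 : V) 1)) := by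
        simp_rw [Measure.addHaar_real_closedBall volume _ (show (0 : ℝ) ≤ 2 / k by positivity)]
        simp
    _ ≤ k * ((2 / k) ^ 2 * volume.real (ball (0 : V) 1)) := by
        have : (2 : ℝ) / k ≤ 1 := by
          rw [div_le_one hk0]
          exact_mod_cast hk
        gcongr ?_ * (?_ * ?_)
        exact pow_le_pow_of_le_one (by positivity) this hN
    _ = _ := by
        field_simp
        ring

open Pointwise in
theorem volume_real_coneAround_inter_ball {u : V} {k : ℕ} {ρ : ℝ} (hρ : 0 < ρ) :
    volume.real (coneAround u k ∩ ball (0 : V) ρ) =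
      ρ ^ finrank ℝ V * volume.real (coneAround u k ∩ ball (0 : V) 1) := by
  have h : volume.real (ρ • (coneAround u k ∩ ball (0 : V) 1)) =
      ρ ^ finrank ℝ V * volume.real (coneAround u k ∩ ball (0 : V) 1) := by
    rw [Measure.real, Measure.addHaar_smul_of_nonneg volume hρ.le, ENNReal.toReal_mul,
      ENNReal.toReal_ofReal (by positivity), Measure.real]
  rw [← h]
  congr 1
  ext x
  rw [mem_smul_set_iff_inv_smul_mem₀ hρ.ne']
  simp only [coneAround, mem_inter_iff, mem_ofPred_eq, mem_ball_zero_iff, norm_smul, norm_inv,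
    Real.norm_of_nonneg hρ.le]
  rw [mul_smul, ← smul_sub, norm_smul, norm_inv, Real.norm_of_nonneg hρ.le, mul_div_assoc,
    mul_le_mul_iff_right₀ (by positivity), inv_mul_lt_iff₀ hρ, mul_one]

theorem volume_real_coneAround_inter_annulus (hN : 2 ≤ finrank ℝ V) {u : V} (hu : ‖u‖ ≤ 1)
    {k : ℕ} (hk : 2 ≤ k) {a b : ℝ} (ha : 0 < a) (hab : a ≤ b) :
    volume.real (coneAround u k ∩ (ball (0 : V) b \ ball 0 a)) ≤
      4 / k * (volume.real (ball (0 : V) 1) * (b ^ finrank ℝ V - a ^ finrank ℝ V)) := by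
  have hb := ha.trans_le hab
  have e : coneAround u k ∩ (ball (0 : V) b \ ball 0 a) =
      (coneAround u k ∩ ball (0 : V) b) \ (coneAround u k ∩ ball (0 : V) a) := by
    ext x
    simp only [mem_inter_iff, mem_sdiff]
    tauto
  rw [e, measureReal_sdiff (inter_subset_inter_right _ (ball_subset_ball hab))
    ((measurableSet_coneAround u k).inter measurableSet_ball)
    ((measure_mono inter_subset_right).trans_lt measure_ball_lt_top).ne,
    volume_real_coneAround_inter_ball ha, volume_real_coneAround_inter_ball hb, ← sub_mul]
  have h1 := volume_real_coneAround_inter_ball_one hN hu hk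
  have h2 : 0 ≤ b ^ finrank ℝ V - a ^ finrank ℝ V := sub_nonneg.2 (by gcongr)
  nlinarith [mul_le_mul_of_nonneg_left h1 h2]

theorem le_norm_sub_of_notMem_coneAround {w x : V} {k : ℕ} (hk : 0 < k)
    (hx : x ∉ coneAround (‖w‖⁻¹ • w) k) : ‖x‖ / (2 * k) ≤ ‖x - w‖ := by
  have hk0 : (0 : ℝ) < k := by positivity
  simp only [coneAround, mem_ofPred_eq, not_le] at hx
  have e : x - ‖x‖ • ‖w‖⁻¹ • w = (x - w) + (‖w‖ - ‖x‖) • ‖w‖⁻¹ • w := by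
    by_cases hw : w = 0
    · simp [hw]
    · rw [sub_smul, smul_inv_smul₀ (norm_ne_zero_iff.2 hw)]
      abel
  have h1 : ‖(‖w‖ - ‖x‖) • ‖w‖⁻¹ • w‖ ≤ ‖x - w‖ := by
    have : ‖‖w‖⁻¹ • w‖ ≤ 1 := by
      rw [norm_smul, norm_inv, norm_norm]
      exact inv_mul_le_one
    rw [norm_smul, Real.norm_eq_abs, norm_sub_rev x w]
    calc _ ≤ ‖w - x‖ * 1 := by
          gcongr
          exact abs_norm_sub_norm_le w x
      _ = _ := mul_one _
  have h2 := norm_add_le (x - w) ((‖w‖ - ‖x‖) • ‖w‖⁻¹ • w)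
  rw [← e] at h2
  rw [mul_comm, ← div_div]
  linarith

theorem norm_inv_norm_smul_le (w : V) : ‖‖w‖⁻¹ • w‖ ≤ 1 := by
  rw [norm_smul, norm_inv, norm_norm]
  exact inv_mul_le_one

theorem volume_real_ball [Nontrivial V] (x : V) {r : ℝ} (hr : 0 ≤ r) :
    volume.real (ball x r) = r ^ finrank ℝ V * volume.real (ball (0 : V) 1) := by
  rw [Measure.real, Measure.addHaar_ball volume x hr, ENNReal.toReal_mul,
    ENNReal.toReal_ofReal (by positivity), Measure.real]

theorem volume_real_annulus [Nontrivial V] {a b : ℝ} (ha : 0 ≤ a) (hab : a < b) :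
    volume.real (ball (0 : V) b \ closedBall 0 a) =
      volume.real (ball (0 : V) 1) * (b ^ finrank ℝ V - a ^ finrank ℝ V) := by
  rw [measureReal_sdiff (closedBall_subset_ball hab) measurableSet_closedBall
    measure_ball_lt_top.ne, Measure.addHaar_real_closedBall _ _ ha,
    volume_real_ball _ (ha.trans hab.le)]
  ring

theorem measureReal_sdiff_comm_of_eq {X : Type*} [MeasurableSpace X] {μ : Measure X} {A B : Set X}
    (hA : MeasurableSet A) (hB : MeasurableSet B) (hA' : μ A ≠ ∞) (h : μ A = μ B) :
    μ.real (A \ B) = μ.real (B \ A) := by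
  have h1 := measureReal_sdiff_add_inter (μ := μ) (s := A) hB hA'
  have h2 := measureReal_sdiff_add_inter (μ := μ) (s := B) hA (h ▸ hA')
  have h3 : μ.real A = μ.real B := by rw [Measure.real, h, Measure.real]
  rw [inter_comm] at h2
  linarith

theorem div_le_inv_max {ω a b d m X : ℝ} {N : ℕ} (hN : 2 ≤ N) (hω : 0 < ω) (ha : 0 ≤ a)
    (hab : a < b) (hb : 1 / 4 ≤ b) (hd : 1 / 2048 ≤ d) (hm : 0 < m) (hmX : m ≤ X)
    (hX : ω * (b ^ N - a ^ N) ≤ X) :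
    min 1 (ω / (2048 * 4 ^ (N - 2))) / X ≤ (max ((b ^ 2 - a ^ 2) / (2 * d)) m)⁻¹ := by
  obtain ⟨k, rfl⟩ : ∃ k, N = k + 2 := ⟨_, (Nat.sub_add_cancel hN).symm⟩
  rw [Nat.add_sub_cancel]
  set c := min 1 (ω / (2048 * 4 ^ k)) with hc
  have hc0 : 0 < c := lt_min one_pos (by positivity)
  have hX0 : 0 < X := hm.trans_le hmX
  rw [div_eq_mul_inv, ← inv_inv c, ← mul_inv]
  refine inv_anti₀ (lt_max_of_lt_right hm) (max_le ?_ ?_)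
  · rw [← div_eq_inv_mul, le_div_iff₀ hc0]
    have h1 : b ^ 2 - a ^ 2 ≤ 2 * (b * (b - a)) := by nlinarith
    have h2 : b * (b - a) ≤ 4 ^ k * (b ^ (k + 2) - a ^ (k + 2)) := by
      have h3 : a ^ (k + 1) ≤ b ^ (k + 1) := by gcongr
      have h4 : 1 ≤ (4 * b) ^ k := one_le_pow₀ (by linarith)
      rw [mul_pow] at h4
      have h5 : a ^ (k + 2) ≤ b ^ (k + 1) * a := by
        rw [pow_succ]; gcongr
      have h6 : 0 ≤ b * (b - a) := mul_nonneg (by linarith) (by linarith)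
      calc b * (b - a) ≤ 4 ^ k * b ^ k * (b * (b - a)) := le_mul_of_one_le_left h6 h4
        _ = 4 ^ k * (b ^ (k + 2) - b ^ (k + 1) * a) := by ring
        _ ≤ _ := by gcongr
    have h3 : (b ^ 2 - a ^ 2) / (2 * d) ≤ 1024 * (b ^ 2 - a ^ 2) := by
      rw [div_le_iff₀ (by linarith)]
      have : 0 ≤ b ^ 2 - a ^ 2 := by nlinarith
      nlinarith
    have h4 : c * (2048 * 4 ^ k) ≤ ω := by
      rw [← le_div_iff₀ (by positivity)]
      exact min_le_right _ _
    have h5 : 0 ≤ b ^ (k + 2) - a ^ (k + 2) := sub_nonneg.2 (by gcongr)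
    calc (b ^ 2 - a ^ 2) / (2 * d) * c ≤ (2048 * (4 ^ k * (b ^ (k + 2) - a ^ (k + 2)))) * c := by
          gcongr
          linarith
      _ = (c * (2048 * 4 ^ k)) * (b ^ (k + 2) - a ^ (k + 2)) := by ring
      _ ≤ ω * (b ^ (k + 2) - a ^ (k + 2)) := by gcongr
      _ ≤ X := hX
  · have : 1 ≤ c⁻¹ := (one_le_inv₀ hc0).2 (min_le_left _ _)
    nlinarith

theorem ofReal_mul_le_setLIntegral {f : V → ℝ≥0∞} {Z : Set V} (hZ : MeasurableSet Z) {a b : ℝ}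
    (ha : 0 ≤ a) (hf : ∀ z ∈ Z, ENNReal.ofReal a ≤ f z) (hb : b ≤ volume.real Z) :
    ENNReal.ofReal (a * b) ≤ ∫⁻ z in Z, f z := by
  rw [ENNReal.ofReal_mul ha]
  calc _ ≤ ENNReal.ofReal a * volume Z := by
        gcongr
        exact ENNReal.ofReal_le_of_le_toReal hb
    _ = ∫⁻ _ in Z, ENNReal.ofReal a := by simp
    _ ≤ _ := setLIntegral_mono' hZ hf

theorem lintegral_lintegral_norm_lt_swap (F : Set V) {f : V × V → ℝ≥0∞}
    (hf : Measurable f) :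
    ∫⁻ y in Fᶜ, ∫⁻ z in F ∩ {z | ‖y‖ < ‖z‖}, f (y, z) =
      ∫⁻ z in F, ∫⁻ y in Fᶜ ∩ {y | ‖y‖ < ‖z‖}, f (y, z) := by
  have hS : MeasurableSet {p : V × V | ‖p.1‖ < ‖p.2‖} :=
    measurableSet_lt (by fun_prop) (by fun_prop)
  have h1 : ∀ y, ∫⁻ z in F ∩ {z | ‖y‖ < ‖z‖}, f (y, z) =
      ∫⁻ z in F, {p : V × V | ‖p.1‖ < ‖p.2‖}.indicator f (y, z) := by
    intro y
    have : MeasurableSet {z : V | ‖y‖ < ‖z‖} := measurableSet_lt (by fun_prop) (by fun_prop)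
    rw [inter_comm, ← Measure.restrict_restrict this, ← lintegral_indicator this]
    rfl
  have h2 : ∀ z, ∫⁻ y in Fᶜ ∩ {y | ‖y‖ < ‖z‖}, f (y, z) =
      ∫⁻ y in Fᶜ, {p : V × V | ‖p.1‖ < ‖p.2‖}.indicator f (y, z) := by
    intro z
    have : MeasurableSet {y : V | ‖y‖ < ‖z‖} := measurableSet_lt (by fun_prop) (by fun_prop)
    rw [inter_comm, ← Measure.restrict_restrict this, ← lintegral_indicator this]
    rfl
  simp_rw [h1, h2]
  exact lintegral_lintegral_swap (hf.indicator hS).aemeasurable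

/-- A lower bound for the amount of mass that can be moved inwards. -/
theorem exists_le_lintegral_lintegral [Nontrivial V] (hN : 2 ≤ finrank ℝ V) :
    ∃ c : ℝ, 0 < c ∧ ∀ (F : Set V) (r : ℝ), MeasurableSet F → 1 / 2 ≤ r →
      volume F = volume (ball (0 : V) r) → 0 < volume.real (F \ ball 0 r) →
      ENNReal.ofReal (c * volume.real (F \ ball 0 r)) ≤
        ∫⁻ y in Fᶜ, ∫⁻ z in F ∩ {z | ‖y‖ < ‖z‖},
          ENNReal.ofReal (max ((‖z‖ ^ 2 - ‖y‖ ^ 2) / (2 * ‖z - y‖))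
            (volume.real (F \ ball 0 r)))⁻¹ := by
  set ω := volume.real (ball (0 : V) 1) with hω
  set N := finrank ℝ V with hNdef
  have hω0 : 0 < ω := ENNReal.toReal_pos (measure_ball_pos _ _ one_pos).ne' measure_ball_lt_top.ne
  set c := min 1 (ω / (2048 * 4 ^ (N - 2))) with hc
  have hc0 : 0 < c := lt_min one_pos (by positivity)
  refine ⟨c / 128, by positivity, fun F r hF hr hFv hm ↦ ?_⟩
  have hr0 : 0 < r := by linarith
  set m := volume.real (F \ ball 0 r) with hmdef
  have hF' : volume F ≠ ∞ := by rw [hFv]; exact measure_ball_lt_top.ne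
  have hm' : volume.real (ball 0 r \ F) = m :=
    measureReal_sdiff_comm_of_eq measurableSet_ball hF measure_ball_lt_top.ne hFv.symm
  set f : V × V → ℝ≥0∞ := fun p ↦ ENNReal.ofReal (max ((‖p.2‖ ^ 2 - ‖p.1‖ ^ 2) /
    (2 * ‖p.2 - p.1‖)) m)⁻¹ with hf
  have hfm : Measurable f := by fun_prop
  change _ ≤ ∫⁻ y in Fᶜ, ∫⁻ z in F ∩ {z | ‖y‖ < ‖z‖}, f (y, z)
  have hk : (2 : ℕ) ≤ 256 := by norm_num
  set C : V → Set V := fun w ↦ coneAround (‖w‖⁻¹ • w) 256 with hCdef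
  have hC : ∀ w, MeasurableSet (C w) := fun w ↦ measurableSet_coneAround _ _
  have hCd : ∀ w x, x ∉ C w → 1 / 4 ≤ ‖x‖ → 1 / 2048 ≤ ‖x - w‖ := by
    intro w x hx hx1
    have := le_norm_sub_of_notMem_coneAround (by norm_num) hx
    push_cast at this
    linarith
  have hCv : ∀ w a b, 0 < a → a ≤ b → volume.real (C w ∩ (ball (0 : V) b \ ball 0 a)) ≤
      1 / 64 * (ω * (b ^ N - a ^ N)) := by
    intro w a b ha hab
    have := volume_real_coneAround_inter_annulus hN (norm_inv_norm_smul_le w) hk ha hab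
    norm_num at this ⊢
    exact this
  have hfin : ∀ {S : Set V} {b : ℝ}, S ⊆ ball 0 b → volume S ≠ ∞ := fun h ↦
    ((measure_mono h).trans_lt measure_ball_lt_top).ne
  set P₁ := {z | z ∈ F \ ball 0 r ∧ ω * (‖z‖ ^ N - r ^ N) < 8 * m} with hP₁
  set P₂ := {z | z ∈ F \ ball 0 r ∧ 8 * m ≤ ω * (‖z‖ ^ N - r ^ N)} with hP₂
  set G₁ := {y | y ∈ ball 0 r \ F ∧ ω * (r ^ N - ‖y‖ ^ N) < 8 * m} with hG₁
  set G₂ := {y | y ∈ ball 0 r \ F ∧ 8 * m ≤ ω * (r ^ N - ‖y‖ ^ N)} with hG₂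
  have hFr : MeasurableSet (F \ ball 0 r) := hF.diff measurableSet_ball
  have hrF : MeasurableSet (ball 0 r \ F) := measurableSet_ball.diff hF
  have hP₁m : MeasurableSet P₁ := by
    have : MeasurableSet {z : V | ω * (‖z‖ ^ N - r ^ N) < 8 * m} :=
      measurableSet_lt (by fun_prop) (by fun_prop)
    exact hFr.inter this
  have hP₂m : MeasurableSet P₂ := by
    have : MeasurableSet {z : V | 8 * m ≤ ω * (‖z‖ ^ N - r ^ N)} :=
      measurableSet_le (by fun_prop) (by fun_prop)
    exact hFr.inter this
  have hG₁m : MeasurableSet G₁ := by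
    have : MeasurableSet {z : V | ω * (r ^ N - ‖z‖ ^ N) < 8 * m} :=
      measurableSet_lt (by fun_prop) (by fun_prop)
    exact hrF.inter this
  have hG₂m : MeasurableSet G₂ := by
    have : MeasurableSet {z : V | 8 * m ≤ ω * (r ^ N - ‖z‖ ^ N)} :=
      measurableSet_le (by fun_prop) (by fun_prop)
    exact hrF.inter this
  have hPsum : m ≤ volume.real P₁ + volume.real P₂ := by
    rw [hmdef]
    refine le_trans (measureReal_mono ?_ ?_) (measureReal_union_le P₁ P₂)
    · intro z hz
      rcases lt_or_ge (ω * (‖z‖ ^ N - r ^ N)) (8 * m) with h | h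
      · exact .inl ⟨hz, h⟩
      · exact .inr ⟨hz, h⟩
    · refine ((measure_mono (?_ : P₁ ∪ P₂ ⊆ F)).trans_lt hF'.lt_top).ne
      exact union_subset (fun z hz ↦ hz.1.1) (fun z hz ↦ hz.1.1)
  have hGsum : m ≤ volume.real G₁ + volume.real G₂ := by
    rw [← hm']
    refine le_trans (measureReal_mono ?_ ?_) (measureReal_union_le G₁ G₂)
    · intro z hz
      rcases lt_or_ge (ω * (r ^ N - ‖z‖ ^ N)) (8 * m) with h | h
      · exact .inl ⟨hz, h⟩
      · exact .inr ⟨hz, h⟩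
    · exact hfin (union_subset (fun z hz ↦ hz.1.1) (fun z hz ↦ hz.1.1))
  rcases le_or_gt (m / 2) (volume.real P₂) with hP | hP
  · rw [lintegral_lintegral_norm_lt_swap F hfm]
    calc ENNReal.ofReal (c / 128 * m) ≤ ENNReal.ofReal (c / 4 * (m / 2)) :=
          ENNReal.ofReal_le_ofReal (by nlinarith)
      _ ≤ ∫⁻ z in P₂, ∫⁻ y in Fᶜ ∩ {y | ‖y‖ < ‖z‖}, f (y, z) := by
          refine ofReal_mul_le_setLIntegral hP₂m (by positivity) (fun z hz ↦ ?_) hP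
          set X := ω * (‖z‖ ^ N - r ^ N) with hX
          have hX0 : 0 < X := by linarith [hz.2]
          have hrz : r < ‖z‖ := by
            by_contra! h
            have : ‖z‖ ^ N ≤ r ^ N := by gcongr
            nlinarith
          set Z := (ball (0 : V) ‖z‖ \ closedBall 0 r) \
            ((F \ ball 0 r) ∪ (C z ∩ (ball (0 : V) ‖z‖ \ ball 0 r))) with hZ
          have hZm : MeasurableSet Z := (measurableSet_ball.diff measurableSet_closedBall).diff
            (hFr.union ((hC z).inter (measurableSet_ball.diff measurableSet_ball)))
          have hZs : ∀ y ∈ Z, y ∉ F ∧ ‖y‖ < ‖z‖ ∧ r < ‖y‖ ∧ y ∉ C z := by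
            rintro y ⟨⟨h1, h2⟩, h3⟩
            simp only [mem_union, mem_sdiff, mem_inter_iff, mem_ball_zero_iff,
              mem_closedBall_zero_iff, not_or, not_and, not_not, not_le] at h1 h2 h3
            refine ⟨fun h ↦ ?_, h1, h2, fun h ↦ ?_⟩
            · linarith [h3.1 h]
            · linarith [h3.2 h h1]
          have hZv : X / 4 ≤ volume.real Z := by
            have h1 := le_measureReal_sdiff (μ := volume) (s₁ := ball (0 : V) ‖z‖ \ closedBall 0 r)
              (s₂ := (F \ ball 0 r) ∪ (C z ∩ (ball (0 : V) ‖z‖ \ ball 0 r)))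
              (measure_union_ne_top ((measure_mono sdiff_subset).trans_lt hF'.lt_top).ne
                (hfin (inter_subset_right.trans sdiff_subset)))
            have h2 := measureReal_union_le (μ := volume) (F \ ball 0 r)
              (C z ∩ (ball (0 : V) ‖z‖ \ ball 0 r))
            have h3 := hCv z r ‖z‖ hr0 hrz.le
            rw [volume_real_annulus hr0.le hrz] at h1
            have := hz.2
            linarith
          calc _ ≤ ENNReal.ofReal (c / X * (X / 4)) := by
                refine ENNReal.ofReal_le_ofReal (le_of_eq ?_)
                field_simp
            _ ≤ ∫⁻ y in Z, f (y, z) := by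
                refine ofReal_mul_le_setLIntegral hZm (by positivity) (fun y hy ↦ ?_) hZv
                obtain ⟨h1, h2, h3, h4⟩ := hZs y hy
                refine ENNReal.ofReal_le_ofReal (div_le_inv_max hN hω0 (norm_nonneg y) h2
                  (by linarith) ?_ hm (by linarith [hz.2]) ?_)
                · rw [norm_sub_rev]
                  exact hCd z y h4 (by linarith)
                · rw [hX]
                  gcongr
            _ ≤ _ := lintegral_mono_set (t := Fᶜ ∩ {y | ‖y‖ < ‖z‖}) fun y hy ↦
                ⟨(hZs y hy).1, (hZs y hy).2.1⟩
      _ ≤ _ := lintegral_mono_set fun z hz ↦ hz.1.1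
  rcases le_or_gt (m / 2) (volume.real G₂) with hG | hG
  · calc ENNReal.ofReal (c / 128 * m) ≤ ENNReal.ofReal (c / 4 * (m / 2)) :=
          ENNReal.ofReal_le_ofReal (by nlinarith)
      _ ≤ ∫⁻ y in G₂, ∫⁻ z in F ∩ {z | ‖y‖ < ‖z‖}, f (y, z) := by
          refine ofReal_mul_le_setLIntegral hG₂m (by positivity) (fun y hy ↦ ?_) hG
          set X := ω * (r ^ N - ‖y‖ ^ N) with hX
          have hX8 : 8 * m ≤ X := hy.2
          have hX0 : 0 < X := by linarith
          have hyr : ‖y‖ < r := mem_ball_zero_iff.1 hy.1.1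
          set a := max ‖y‖ (r / 2) with ha
          have har : a < r := max_lt hyr (by linarith)
          have ha0 : 0 < a := lt_max_of_lt_right (by linarith)
          have haX : X / 2 ≤ ω * (r ^ N - a ^ N) := by
            rcases max_choice ‖y‖ (r / 2) with h | h
            · rw [ha, h]; linarith
            · rw [ha, h, hX, div_pow]
              have h1 : (2 : ℝ) ≤ 2 ^ N := by
                calc (2 : ℝ) = 2 ^ 1 := (pow_one _).symm
                  _ ≤ 2 ^ N := pow_le_pow_right₀ (by norm_num) (by omega)
              have h2 : r ^ N / 2 ^ N ≤ r ^ N / 2 := by gcongr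
              have h3 : 0 ≤ ‖y‖ ^ N := by positivity
              nlinarith
          set Z := (ball (0 : V) r \ closedBall 0 a) \
            ((ball 0 r \ F) ∪ (C y ∩ (ball (0 : V) r \ ball 0 a))) with hZ
          have hZm : MeasurableSet Z := (measurableSet_ball.diff measurableSet_closedBall).diff
            (hrF.union ((hC y).inter (measurableSet_ball.diff measurableSet_ball)))
          have hZs : ∀ z ∈ Z, z ∈ F ∧ ‖y‖ < ‖z‖ ∧ r / 2 < ‖z‖ ∧ ‖z‖ < r ∧ z ∉ C y := by
            rintro z ⟨⟨h1, h2⟩, h3⟩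
            simp only [mem_union, mem_sdiff, mem_inter_iff, mem_ball_zero_iff,
              mem_closedBall_zero_iff, not_or, not_and, not_not, not_le] at h1 h2 h3
            refine ⟨h3.1 h1, (le_max_left _ _).trans_lt h2, (le_max_right _ _).trans_lt h2, h1,
              fun h ↦ ?_⟩
            linarith [h3.2 h h1]
          have hZv : X / 4 ≤ volume.real Z := by
            have h1 := le_measureReal_sdiff (μ := volume) (s₁ := ball (0 : V) r \ closedBall 0 a)
              (s₂ := (ball 0 r \ F) ∪ (C y ∩ (ball (0 : V) r \ ball 0 a)))
              (hfin (union_subset sdiff_subset (inter_subset_right.trans sdiff_subset)))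
            have h2 := measureReal_union_le (μ := volume) (ball 0 r \ F)
              (C y ∩ (ball (0 : V) r \ ball 0 a))
            have h3 := hCv y a r ha0 har.le
            rw [volume_real_annulus ha0.le har] at h1
            linarith
          calc _ ≤ ENNReal.ofReal (c / X * (X / 4)) := by
                refine ENNReal.ofReal_le_ofReal (le_of_eq ?_)
                field_simp
            _ ≤ ∫⁻ z in Z, f (y, z) := by
                refine ofReal_mul_le_setLIntegral hZm (by positivity) (fun z hz ↦ ?_) hZv
                obtain ⟨h1, h2, h3, h4, h5⟩ := hZs z hz
                refine ENNReal.ofReal_le_ofReal (div_le_inv_max hN hω0 (norm_nonneg y) h2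
                  (by linarith) (hCd y z h5 (by linarith)) hm (by linarith) ?_)
                rw [hX]
                gcongr
            _ ≤ _ := lintegral_mono_set (t := F ∩ {z | ‖y‖ < ‖z‖}) fun z hz ↦
                ⟨(hZs z hz).1, (hZs z hz).2.1⟩
      _ ≤ _ := lintegral_mono_set fun z hz ↦ hz.1.2
  · have hP' : m / 2 ≤ volume.real P₁ := by linarith
    have hG' : m / 2 ≤ volume.real G₁ := by linarith
    obtain ⟨ρ, hρ0, hρ⟩ : ∃ ρ : ℝ, 0 ≤ ρ ∧ ρ ^ N = r ^ N + 8 * m / ω :=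
      ⟨(r ^ N + 8 * m / ω) ^ ((N : ℝ)⁻¹), by positivity,
        Real.rpow_inv_natCast_pow (by positivity) (by omega)⟩
    have hrρ : r ≤ ρ := by
      refine le_of_pow_le_pow_left₀ (show N ≠ 0 by omega) hρ0 ?_
      rw [hρ]
      have : 0 ≤ 8 * m / ω := by positivity
      linarith
    have hρm : ω * (ρ ^ N - r ^ N) = 8 * m := by
      rw [hρ]; field_simp; ring
    calc ENNReal.ofReal (c / 128 * m) = ENNReal.ofReal (c / 64 * (m / 2)) := by
          congr 1; ring
      _ ≤ ∫⁻ y in G₁, ∫⁻ z in F ∩ {z | ‖y‖ < ‖z‖}, f (y, z) := by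
          refine ofReal_mul_le_setLIntegral hG₁m (by positivity) (fun y hy ↦ ?_) hG'
          have hyr : ‖y‖ < r := mem_ball_zero_iff.1 hy.1.1
          set Z := P₁ \ (C y ∩ (ball (0 : V) ρ \ ball 0 r)) with hZ
          have hZm : MeasurableSet Z :=
            hP₁m.diff ((hC y).inter (measurableSet_ball.diff measurableSet_ball))
          have hZs : ∀ z ∈ Z, z ∈ F ∧ r ≤ ‖z‖ ∧ z ∉ C y := by
            rintro z ⟨⟨⟨h1, h2⟩, h3⟩, h4⟩
            rw [mem_ball_zero_iff, not_lt] at h2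
            refine ⟨h1, h2, fun h ↦ h4 ⟨h, ?_, by rwa [mem_ball_zero_iff, not_lt]⟩⟩
            rw [mem_ball_zero_iff]
            refine lt_of_pow_lt_pow_left₀ N hρ0 ?_
            rw [← hρm] at h3
            have := lt_of_mul_lt_mul_left h3 hω0.le
            linarith
          have hZv : m / 4 ≤ volume.real Z := by
            have h1 := le_measureReal_sdiff (μ := volume) (s₁ := P₁)
              (s₂ := C y ∩ (ball (0 : V) ρ \ ball 0 r))
              (hfin (inter_subset_right.trans sdiff_subset))
            have h3 := hCv y r ρ hr0 hrρ
            rw [hρm] at h3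
            linarith
          calc _ = ENNReal.ofReal (c / (16 * m) * (m / 4)) := by
                congr 1
                field_simp
                norm_num
            _ ≤ ∫⁻ z in Z, f (y, z) := by
                refine ofReal_mul_le_setLIntegral hZm (by positivity) (fun z hz ↦ ?_) hZv
                obtain ⟨h1, h2, h3⟩ := hZs z hz
                refine ENNReal.ofReal_le_ofReal (div_le_inv_max hN hω0 (norm_nonneg y)
                  (by linarith) (by linarith) (hCd y z h3 (by linarith)) hm (by linarith) ?_)
                have h4 := hy.2
                have h5 := hz.1.2
                linarith
            _ ≤ _ := lintegral_mono_set (t := F ∩ {z | ‖y‖ < ‖z‖}) fun z hz ↦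
                ⟨(hZs z hz).1, hyr.trans_le (hZs z hz).2.1⟩
      _ ≤ _ := lintegral_mono_set fun z hz ↦ hz.1.2

/-- Almost maximizers with barycenter `0` contained in a fixed ball are close to a centered ball. -/
theorem exists_volume_diff_ball_le [Nontrivial V] (hN : 2 ≤ finrank ℝ V) {s R : ℝ}
    (hs : 0 < s) (hs' : s < finrank ℝ V) (hR : 0 < R) :
    ∃ K : ℝ, 0 < K ∧ ∀ (D r : ℝ) (F : Set V), 0 ≤ D → 1 / 2 ≤ r → MeasurableSet F →
      F ⊆ ball 0 R → ∫ x in F, x = 0 → volume F = volume (ball (0 : V) r) →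
      (∀ F' : Set V, MeasurableSet F' → volume F' = volume F →
        mutualEnergy s F' F' ≤ mutualEnergy s F F + ENNReal.ofReal D) →
      volume.real (F \ ball 0 r) ≤ K * √D := by
  have hv : 0 < volume.real (ball (0 : V) (1 / 2)) :=
    ENNReal.toReal_pos (measure_ball_pos _ _ (by norm_num)).ne' measure_ball_lt_top.ne
  obtain ⟨K, hK, h1⟩ := exists_lintegral_lintegral_le hN hs hs' hR hv
  obtain ⟨c, hc, h2⟩ := exists_le_lintegral_lintegral hN (V := V)
  refine ⟨2 * K / c + 1, by positivity, fun D r F hD hr hF hFR hF0 hFv hmax ↦ ?_⟩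
  rcases (measureReal_nonneg (μ := volume) (s := F \ ball 0 r)).eq_or_lt with hm | hm
  · rw [← hm]; positivity
  have h3 := (h2 F r hF hr hFv hm).trans (h1 D F hD hF hFR hF0 (by
    rw [Measure.real, Measure.real, hFv]
    exact measureReal_mono (ball_subset_ball hr) measure_ball_lt_top.ne) hmax _ hm)
  set m := volume.real (F \ ball 0 r)
  rw [ENNReal.ofReal_le_ofReal_iff (by positivity)] at h3
  by_contra! h
  set q := √D with hq
  have hq0 : 0 ≤ q := Real.sqrt_nonneg D
  have hD' : D = q ^ 2 := (Real.sq_sqrt hD).symm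
  have hqm : q < m := by
    have : 0 ≤ 2 * K / c * q := by positivity
    nlinarith
  have h4 : D / m ≤ q := by
    rw [div_le_iff₀ hm, hD']
    nlinarith
  have h5 : c * m ≤ 2 * K * q := by nlinarith
  have h6 : m ≤ 2 * K / c * q := by
    rw [div_mul_eq_mul_div, le_div_iff₀ hc]
    linarith
  nlinarith

/-- A union of balls of a fixed radius, centered at equidistant points on a line, captures little
mass on average. -/
theorem sum_volume_real_inter_ball_le {E : Set V} (hE : MeasurableSet E) (hE' : volume E ≠ ∞)
    {n : V} (hn : ‖n‖ = 1) (p : V) {L : ℝ} (hL : 0 < L) (J : Finset ℕ) :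
    ∑ j ∈ J, volume.real (E ∩ ball (p + (3 * L * j) • n) L) ≤ volume.real E := by
  have hd : (J : Set ℕ).PairwiseDisjoint fun j : ℕ ↦ E ∩ ball (p + (3 * L * j) • n) L := by
    intro i _ j _ hij
    refine Disjoint.mono inter_subset_right inter_subset_right (ball_disjoint_ball ?_)
    rw [dist_add_left, dist_eq_norm, ← sub_smul, norm_smul, hn, mul_one, ← mul_sub, norm_mul,
      Real.norm_of_nonneg (by positivity)]
    have h1 : (1 : ℝ) ≤ ‖(i : ℝ) - j‖ := by
      have h2 : (1 : ℤ) ≤ |(i : ℤ) - j| := Int.one_le_abs (by omega)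
      rw [Real.norm_eq_abs]
      exact_mod_cast h2
    nlinarith
  rw [← measureReal_biUnion_finset hd (fun j _ ↦ hE.inter measurableSet_ball)
    (fun j _ ↦ measure_ne_top_of_subset inter_subset_left hE')]
  exact measureReal_mono (iUnion₂_subset fun j _ ↦ inter_subset_left) hE'

theorem exists_volume_real_inter_ball_lt {E : Set V} (hE : MeasurableSet E) (hE' : volume E ≠ ∞)
    {n : V} (hn : ‖n‖ = 1) (p q : V) {L : ℝ} (hL : 0 < L) {k : ℕ} {c : ℝ}
    (hk : 2 * volume.real E < c * k) :
    ∃ j ≤ k, volume.real (E ∩ ball (p + (3 * L * j) • n) L) +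
      volume.real (E ∩ ball (q + (3 * L * j) • n) L) < c := by
  have h1 := sum_volume_real_inter_ball_le hE hE' hn p hL (Finset.range k)
  have h2 := sum_volume_real_inter_ball_le hE hE' hn q hL (Finset.range k)
  have h3 : ∑ j ∈ Finset.range k, (volume.real (E ∩ ball (p + (3 * L * j) • n) L) +
      volume.real (E ∩ ball (q + (3 * L * j) • n) L)) < ∑ _j ∈ Finset.range k, c := by
    rw [Finset.sum_add_distrib, Finset.sum_const, Finset.card_range, nsmul_eq_mul]
    linarith
  obtain ⟨j, hj, h⟩ := Finset.exists_lt_of_sum_lt h3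
  exact ⟨j, (Finset.mem_range.1 hj).le, h⟩

/-- Points of large potential capture a definite amount of mass in a ball of fixed radius. -/
theorem exists_le_volume_real_inter_ball [Nontrivial V] {s θ ω : ℝ} (hs : 0 < s)
    (hs' : s < finrank ℝ V) (hθ : 0 < θ) (hω : 0 < ω) :
    ∃ L c : ℝ, 0 < L ∧ 0 < c ∧ ∀ (E : Set V) (x : V), MeasurableSet E →
      volume E = ENNReal.ofReal ω → ENNReal.ofReal θ < ∫⁻ y in E, rieszKernel s x y →
      c ≤ volume.real (E ∩ ball x L) := by
  set L := (θ / (2 * ω)) ^ (-s⁻¹) with hLdef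
  have hL : 0 < L := by positivity
  have hLs : L ^ (-s) = θ / (2 * ω) := by
    rw [hLdef, ← Real.rpow_mul (by positivity), neg_mul_neg, inv_mul_cancel₀ hs.ne', Real.rpow_one]
  obtain ⟨c, hc, h⟩ := exists_potential_lt_of_volume_lt (V := V) hs' L
    (θ := ENNReal.ofReal (θ / 2)) (by simpa using hθ)
  refine ⟨L, (min c 1).toReal, hL, ENNReal.toReal_pos (lt_min hc one_pos).ne' (by simp),
    fun E x hE hEω hx ↦ ?_⟩
  refine ENNReal.toReal_mono
    (measure_ne_top_of_subset inter_subset_left (by simp [hEω])) ((min_le_left _ _).trans ?_)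
  by_contra! hlt
  refine hx.not_ge ?_
  rw [← lintegral_inter_add_sdiff _ E (measurableSet_ball (x := x) (ε := L))]
  calc _ ≤ ENNReal.ofReal (θ / 2) + ENNReal.ofReal (θ / (2 * ω)) * ENNReal.ofReal ω := by
        rw [← hLs, ← hEω]
        exact add_le_add (h E x hE hlt).le (potential_diff_ball_le hs hL x hE)
    _ = ENNReal.ofReal θ := by
        rw [← ENNReal.ofReal_mul (by positivity), ← ENNReal.ofReal_add (by positivity)
          (by positivity)]
        congr 1
        field_simp
        norm_num

/-- For an almost maximizer, the points of large potential lie in a bounded region. -/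
theorem exists_norm_sub_lt_of_lt_potential [Nontrivial V] {s θ ω : ℝ} (hs : 0 < s)
    (hs' : s < finrank ℝ V) (hθ : 0 < θ) (hω : 0 < ω) :
    ∃ κ R : ℝ, 0 < κ ∧ 0 < R ∧ ∀ (D : ℝ) (E : Set V), D ≤ κ → MeasurableSet E →
      volume E = ENNReal.ofReal ω →
      (∀ F : Set V, MeasurableSet F → volume F = volume E →
        mutualEnergy s F F ≤ mutualEnergy s E E + ENNReal.ofReal D) →
      ∀ x₁ x₂ : V, ENNReal.ofReal θ < ∫⁻ y in E, rieszKernel s x₁ y →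
        ENNReal.ofReal θ < ∫⁻ y in E, rieszKernel s x₂ y → ‖x₂ - x₁‖ < R := by
  obtain ⟨L, c, hL, hc, hLc⟩ := exists_le_volume_real_inter_ball (V := V) hs hs' hθ hω
  obtain ⟨k, hk⟩ := exists_nat_gt (2 * ω / (c / 2))
  rw [div_lt_iff₀ (by positivity), mul_comm _ (c / 2)] at hk
  set a := (3 * k + 2) * L with ha
  have ha0 : 0 < a := by positivity
  set γ := a ^ (-s) - (2 * a) ^ (-s) with hγ
  have hγ0 : 0 < γ := sub_pos.2 (Real.rpow_lt_rpow_of_neg ha0 (by linarith) (by linarith))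
  refine ⟨γ * (c / 2) * (c / 2), (6 * k + 6) * L, by positivity, by positivity,
    fun D E hD hE hEω hmax x₁ x₂ hx₁ hx₂ ↦ ?_⟩
  have hE' : volume E ≠ ∞ := by simp [hEω]
  have hEr : volume.real E = ω := by rw [Measure.real, hEω, ENNReal.toReal_ofReal hω.le]
  by_contra! hR
  set ℓ := ‖x₂ - x₁‖ with hℓ
  have hℓ0 : 0 < ℓ := lt_of_lt_of_le (by positivity) hR
  set n := ℓ⁻¹ • (x₂ - x₁) with hndef
  have hn : ‖n‖ = 1 := by
    rw [hndef, norm_smul, norm_inv, Real.norm_of_nonneg hℓ0.le, inv_mul_cancel₀ hℓ0.ne']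
  have hx₂' : x₂ = x₁ + ℓ • n := by
    rw [hndef, smul_inv_smul₀ hℓ0.ne', add_sub_cancel]
  obtain ⟨j, hjk, hj⟩ := exists_volume_real_inter_ball_lt hE hE' hn x₁ x₂ hL (hEr ▸ hk)
  have hj' : (j : ℝ) ≤ k := by exact_mod_cast hjk
  have hjL : j * L ≤ k * L := by gcongr
  have hj0 : 0 ≤ j * L := by positivity
  set p := x₁ + (3 * L * j) • n with hp
  set q := x₂ + (3 * L * j) • n with hq
  set t := ⟪x₁, n⟫ + (ℓ + 3 * L * j) / 2 with ht
  set σ := hyperplaneReflection n t with hσ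
  have hnn : ⟪n, n⟫ = 1 := by rw [real_inner_self_eq_norm_sq, hn, one_pow]
  have hσx₁ : σ x₁ = q := by
    rw [hσ, hyperplaneReflection, hq, hx₂', ht]
    module
  have hσp : σ p = x₂ := by
    rw [hσ, hyperplaneReflection, hp, hx₂', ht, inner_add_left, real_inner_smul_left, hnn]
    module
  have hσσ : ∀ x, σ (σ x) = x := hyperplaneReflection_hyperplaneReflection hn t
  have hσn : ∀ x y, ‖σ x - σ y‖ = ‖x - y‖ := norm_hyperplaneReflection_sub hn t
  have hmp : MeasurePreserving σ volume volume := measurePreserving_hyperplaneReflection hn t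
  have hinner : ∀ {x y : V}, x ∈ ball y L → ⟪x, n⟫ < ⟪y, n⟫ + L := by
    intro x y hxy
    have h1 := real_inner_le_norm (x - y) n
    rw [hn, mul_one, inner_sub_left] at h1
    rw [mem_ball_iff_norm] at hxy
    linarith
  set A := (E ∩ ball x₁ L) ∩ σ ⁻¹' Eᶜ with hA
  set B := σ ⁻¹' (E ∩ ball x₂ L) ∩ Eᶜ with hB
  have hAm : MeasurableSet A := (hE.inter measurableSet_ball).inter (hmp.measurable hE.compl)
  have hBm : MeasurableSet B := (hmp.measurable (hE.inter measurableSet_ball)).inter hE.compl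
  have hBp : ∀ y ∈ B, y ∈ ball p L := fun y hy ↦ by
    have := hy.1.2
    rwa [mem_ball_iff_norm, ← hσp, hσn, ← mem_ball_iff_norm] at this
  have hAF : A ⊆ polarizationFixed E n t := fun x hx ↦ by
    refine ⟨?_, hx.1.1, hx.2⟩
    have := hinner hx.1.2
    linarith
  have hBM : B ⊆ polarizationMoved E n t := fun y hy ↦ by
    refine ⟨?_, hy.2, hy.1.1⟩
    have := hinner (hBp y hy)
    rw [hp, inner_add_left, real_inner_smul_left, hnn] at this
    linarith
  have hfin : ∀ {S : Set V}, volume (E ∩ S) ≠ ∞ := measure_ne_top_of_subset inter_subset_left hE'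
  have hreal : ∀ x, volume.real (σ ⁻¹' (E ∩ ball x L)) = volume.real (E ∩ ball x L) := fun x ↦
    hmp.measureReal_preimage (hE.inter measurableSet_ball).nullMeasurableSet
  have hAv : c / 2 ≤ volume.real A := by
    have h1 : volume.real (E ∩ ball x₁ L) ≤ volume.real (A ∪ σ ⁻¹' (E ∩ ball q L)) := by
      refine measureReal_mono (fun x hx ↦ ?_) (measure_union_ne_top
        (measure_ne_top_of_subset inter_subset_left hfin) ?_)
      · by_cases h : σ x ∈ E
        · refine .inr ⟨h, ?_⟩
          rw [mem_ball_iff_norm, ← hσx₁, hσn, ← mem_ball_iff_norm]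
          exact hx.2
        · exact .inl ⟨hx, h⟩
      · rw [hmp.measure_preimage (hE.inter measurableSet_ball).nullMeasurableSet]
        exact hfin
    have h2 := measureReal_union_le (μ := volume) A (σ ⁻¹' (E ∩ ball q L))
    have h3 := hLc E x₁ hE hEω hx₁
    have h4 : 0 ≤ volume.real (E ∩ ball p L) := measureReal_nonneg
    rw [hreal] at h2
    linarith
  have hBv : c / 2 ≤ volume.real B := by
    have h1 : volume.real (σ ⁻¹' (E ∩ ball x₂ L)) ≤ volume.real (B ∪ (E ∩ ball p L)) := by
      refine measureReal_mono (fun y hy ↦ ?_) (measure_union_ne_top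
        (measure_ne_top_of_subset inter_subset_left ?_) hfin)
      · by_cases h : y ∈ E
        · refine .inr ⟨h, ?_⟩
          rw [mem_ball_iff_norm, ← hσn, hσp, ← mem_ball_iff_norm]
          exact hy.2
        · exact .inl ⟨hy, h⟩
      · rw [hmp.measure_preimage (hE.inter measurableSet_ball).nullMeasurableSet]
        exact hfin
    have h2 := measureReal_union_le (μ := volume) B (E ∩ ball p L)
    have h3 := hLc E x₂ hE hEω hx₂
    have h4 : 0 ≤ volume.real (E ∩ ball q L) := measureReal_nonneg
    rw [hreal] at h1
    linarith
  classical
  have key := mutualEnergy_add_polarization_le hn t s hE hmax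
    (fun x y ↦ if x ∈ A ∧ y ∈ B then ENNReal.ofReal γ else 0) (by
    intro x hx y hy
    have hxy : x ≠ y := fun h ↦ hy.2.1 (h ▸ hx.2.1)
    split_ifs with h
    · have hpx : ‖x - y‖ ≤ a := by
        have h1 := h.1.1.2
        have h2 := hBp y h.2
        rw [mem_ball_iff_norm] at h1 h2
        have h3 : ‖x - y‖ ≤ ‖x - x₁‖ + ‖x₁ - p‖ + ‖y - p‖ := by
          rw [norm_sub_rev y p]
          refine (congrArg norm ?_).trans_le (norm_add₃_le (a := x - x₁) (b := x₁ - p) (c := p - y))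
          abel
        have h4 : ‖x₁ - p‖ = 3 * L * j := by
          rw [hp, sub_add_cancel_left, norm_neg, norm_smul, hn, mul_one,
            Real.norm_of_nonneg (by positivity)]
        rw [ha]
        linarith
      have hpx' : 2 * a ≤ ‖x - σ y‖ := by
        have h1 := h.1.1.2
        have h2 := h.2.1.2
        rw [mem_ball_iff_norm] at h1 h2
        have h3 : ℓ ≤ ‖x - x₁‖ + ‖x - σ y‖ + ‖σ y - x₂‖ := by
          rw [hℓ, norm_sub_rev, norm_sub_rev x x₁]
          refine (congrArg norm ?_).trans_le
            (norm_add₃_le (a := x₁ - x) (b := x - σ y) (c := σ y - x₂))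
          abel
        rw [ha]
        linarith
      calc _ ≤ ENNReal.ofReal ((2 * a) ^ (-s)) + ENNReal.ofReal γ := by
            gcongr
            exact rieszKernel_le_of_le_norm hs (by positivity) hpx'
        _ = ENNReal.ofReal (a ^ (-s)) := by
            rw [← ENNReal.ofReal_add (by positivity) hγ0.le, hγ, add_sub_cancel]
        _ ≤ _ := le_rieszKernel_of_norm_le hs hxy hpx
    · rw [add_zero]
      refine rieszKernel_le_of_le_norm hs (norm_sub_pos_iff.2 hxy) ?_
      have h1 := norm_sub_hyperplaneReflection_sq hn t x y
      have h2 : 0 ≤ 4 * (t - ⟪x, n⟫) * (t - ⟪y, n⟫) :=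
        mul_nonneg (mul_nonneg (by norm_num) (sub_nonneg.2 hx.1.le)) (sub_nonneg.2 hy.1.le)
      exact le_of_sq_le_sq (by linarith) (norm_nonneg _))
  have hlow : ENNReal.ofReal (γ * (c / 2) * (c / 2)) ≤
      ∫⁻ x in polarizationFixed E n t, ∫⁻ y in polarizationMoved E n t,
        if x ∈ A ∧ y ∈ B then ENNReal.ofReal γ else 0 := by
    refine le_trans ?_ (lintegral_mono_set hAF)
    refine ofReal_mul_le_setLIntegral hAm (by positivity) (fun x hx ↦ ?_) hAv
    refine le_trans ?_ (lintegral_mono_set hBM)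
    refine ofReal_mul_le_setLIntegral hBm hγ0.le (fun y hy ↦ ?_) hBv
    rw [if_pos ⟨hx, hy⟩]
  have hfinE : mutualEnergy s E E ≠ ∞ := mutualEnergy_ne_top hs hs' hE hE' hE'
  have h5 := (ENNReal.add_le_add_iff_left hfinE).1 key
  have h6 : ENNReal.ofReal (2 * (γ * (c / 2) * (c / 2))) ≤ ENNReal.ofReal D := by
    rw [ENNReal.ofReal_mul (by norm_num), ENNReal.ofReal_ofNat]
    exact le_trans (by gcongr) h5
  have h7 : 0 < γ * (c / 2) * (c / 2) := by positivity
  rw [ENNReal.ofReal_le_ofReal_iff'] at h6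
  rcases h6 with h6 | h6 <;> linarith

theorem mutualEnergy_self_le (s : ℝ) {E G : Set V} (hE : MeasurableSet E) (hG : MeasurableSet G)
    (hGE : G ⊆ E) : mutualEnergy s E E ≤ mutualEnergy s G G + 2 * mutualEnergy s (E \ G) E := by
  have hd : Disjoint G (E \ G) := disjoint_sdiff_right
  have h1 := mutualEnergy_self_union s (hE.diff hG) hd
  have h2 := mutualEnergy_union_right s (E \ G) (hE.diff hG) hd
  rw [union_sdiff_cancel hGE] at h1 h2
  rw [h1, h2, add_assoc, mutualEnergy_comm s G (E \ G), mul_add]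
  gcongr
  rw [two_mul]
  exact le_self_add

theorem mutualEnergy_le_of_volume_eq_ball {s : ℝ} (hs' : s < finrank ℝ V) {S : ℝ≥0∞}
    (hS : ∀ F : Set V, MeasurableSet F → volume F = volume (ball (0 : V) 1) →
      mutualEnergy s F F ≤ S) {r : ℝ} (hr : 0 < r) (hr' : r ≤ 1) {F : Set V}
    (hF : MeasurableSet F) (hFv : volume F = volume (ball (0 : V) r)) :
    mutualEnergy s F F ≤ ENNReal.ofReal (r ^ finrank ℝ V) * S := by
  set N := finrank ℝ V
  have h1 := hS ((r • ·) ⁻¹' F) (measurable_const_smul r hF) (by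
    rw [volume_preimage_smul hr hF, hFv, Measure.addHaar_ball_of_pos _ _ hr, ← mul_assoc,
      ← ENNReal.ofReal_mul (by positivity), inv_mul_cancel₀ (by positivity), ENNReal.ofReal_one,
      one_mul])
  rw [mutualEnergy_preimage_smul s hr hF] at h1
  have h2 : r ^ N ≤ r ^ s := by
    rw [← Real.rpow_natCast]
    exact Real.rpow_le_rpow_of_exponent_ge hr hr' hs'.le
  calc mutualEnergy s F F = ENNReal.ofReal 1 * mutualEnergy s F F := by simp
    _ ≤ ENNReal.ofReal (r ^ N * (r ^ s * ((r ^ N)⁻¹) ^ 2)) * mutualEnergy s F F := by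
        gcongr
        calc 1 = r ^ N * (r ^ N * ((r ^ N)⁻¹) ^ 2) := by field_simp
          _ ≤ _ := by gcongr
    _ = ENNReal.ofReal (r ^ N) *
          (ENNReal.ofReal (r ^ s * ((r ^ N)⁻¹) ^ 2) * mutualEnergy s F F) := by
        rw [ENNReal.ofReal_mul (by positivity), mul_assoc]
    _ ≤ _ := by gcongr

/-- Removing the points of low potential from an almost maximizer removes little mass, and leaves
an almost maximizer. -/
theorem exists_volume_truncation_eq [Nontrivial V] {s S D : ℝ} (hs : 0 < s)
    (hs' : s < finrank ℝ V) (hS0 : 0 < S)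
    (hS : ∀ F : Set V, MeasurableSet F → volume F = volume (ball (0 : V) 1) →
      mutualEnergy s F F ≤ ENNReal.ofReal S) (hD : 0 ≤ D) (hDS : D ≤ S / 4) {E : Set V}
    (hE : MeasurableSet E) (hEv : volume E = volume (ball (0 : V) 1))
    (hED : ENNReal.ofReal S ≤ mutualEnergy s E E + ENNReal.ofReal D) {G : Set V}
    (hG : G = E ∩ {x | ENNReal.ofReal (S / (4 * volume.real (ball (0 : V) 1))) <
      ∫⁻ y in E, rieszKernel s x y}) :
    ∃ r : ℝ, 1 / 2 ≤ r ∧ r ≤ 1 ∧ volume G = volume (ball (0 : V) r) ∧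
      volume.real (E \ G) ≤ 2 * volume.real (ball (0 : V) 1) / S * D ∧
      ENNReal.ofReal S ≤ mutualEnergy s G G + ENNReal.ofReal (2 * D) := by
  set ω := volume.real (ball (0 : V) 1) with hω
  have hω0 : 0 < ω := ENNReal.toReal_pos (measure_ball_pos _ _ one_pos).ne' measure_ball_lt_top.ne
  set N := finrank ℝ V with hN
  have hN0 : N ≠ 0 := finrank_pos.ne'
  set θ := S / (4 * ω) with hθ
  have hθ0 : 0 < θ := by positivity
  have hE' : volume E ≠ ∞ := by rw [hEv]; exact measure_ball_lt_top.ne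
  have hEr : volume.real E = ω := by rw [Measure.real, hEv, hω, Measure.real]
  have hGm : MeasurableSet G := by
    rw [hG]
    exact hE.inter (measurableSet_lt measurable_const (measurable_potential s E))
  have hGE : G ⊆ E := hG ▸ inter_subset_left
  have hG' : volume G ≠ ∞ := measure_ne_top_of_subset hGE hE'
  have hBm : MeasurableSet (E \ G) := hE.diff hGm
  have hB' : volume (E \ G) ≠ ∞ := measure_ne_top_of_subset sdiff_subset hE'
  set b := volume.real (E \ G) with hb
  have hb0 : 0 ≤ b := measureReal_nonneg
  have hGb : volume.real G = ω - b := by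
    have := measureReal_sdiff_add_inter (μ := volume) (s := E) hGm hE'
    rw [inter_eq_self_of_subset_right hGE, hEr] at this
    linarith
  have hbω : b ≤ ω := by
    have : 0 ≤ volume.real G := measureReal_nonneg
    linarith
  have hlow : mutualEnergy s (E \ G) E ≤ ENNReal.ofReal (θ * b) := by
    rw [ENNReal.ofReal_mul hθ0.le, hb, ofReal_measureReal hB']
    calc mutualEnergy s (E \ G) E ≤ ∫⁻ _ in E \ G, ENNReal.ofReal θ := by
          refine setLIntegral_mono' hBm fun x hx ↦ ?_
          by_contra! h
          exact hx.2 (hG ▸ ⟨hx.1, h⟩)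
      _ = _ := by simp
  have hsplit : mutualEnergy s E E ≤ mutualEnergy s G G + ENNReal.ofReal (2 * (θ * b)) := by
    rw [ENNReal.ofReal_mul (by norm_num), ENNReal.ofReal_ofNat]
    exact (mutualEnergy_self_le s hE hGm hGE).trans (by gcongr)
  set e := (mutualEnergy s G G).toReal with he
  have hee : mutualEnergy s G G = ENNReal.ofReal e :=
    (ENNReal.ofReal_toReal (mutualEnergy_ne_top hs hs' hGm hG' hG')).symm
  have he0 : 0 ≤ e := ENNReal.toReal_nonneg
  have h1 : S ≤ e + 2 * (θ * b) + D := by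
    rw [← ENNReal.ofReal_le_ofReal_iff (by positivity), ENNReal.ofReal_add (by positivity) hD,
      ENNReal.ofReal_add he0 (by positivity), ← hee]
    exact hED.trans (by gcongr)
  have hθb : θ * b = S * (b / ω) / 4 := by
    rw [hθ]
    field_simp
  obtain ⟨r, hr0, hr⟩ : ∃ r : ℝ, 0 ≤ r ∧ r ^ N = 1 - b / ω := by
    have : 0 ≤ 1 - b / ω := sub_nonneg.2 ((div_le_one hω0).2 hbω)
    exact ⟨(1 - b / ω) ^ ((N : ℝ)⁻¹), by positivity, Real.rpow_inv_natCast_pow this hN0⟩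
  have hr1 : r ≤ 1 := by
    rw [← pow_le_one_iff_of_nonneg hr0 hN0, hr]
    have : 0 ≤ b / ω := by positivity
    linarith
  have hGr : volume G = volume (ball (0 : V) r) := by
    rw [← ENNReal.toReal_eq_toReal_iff' hG' measure_ball_lt_top.ne]
    change volume.real G = volume.real (ball 0 r)
    rw [volume_real_ball _ hr0, hr, hGb, ← hω]
    field_simp
  have h2 : e ≤ r ^ N * S := by
    rcases hr0.eq_or_lt with h | h
    · have : mutualEnergy s G G = 0 := by
        rw [← h, ball_zero] at hGr
        simp [mutualEnergy, Measure.restrict_eq_zero.2 (hGr.trans measure_empty)]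
      rw [he, this, ENNReal.toReal_zero]
      positivity
    · rw [← ENNReal.ofReal_le_ofReal_iff (by positivity), ← hee, ENNReal.ofReal_mul (by positivity)]
      exact mutualEnergy_le_of_volume_eq_ball hs' hS h hr1 hGm hGr
  rw [hr] at h2
  have h3 : S * (b / ω) ≤ 2 * D := by nlinarith
  refine ⟨r, ?_, hr1, hGr, ?_, ?_⟩
  · rw [← pow_le_pow_iff_left₀ (by norm_num) hr0 hN0, hr]
    have h4 : (1 / 2 : ℝ) ^ N ≤ 1 / 2 := pow_le_of_le_one (by norm_num) (by norm_num) hN0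
    nlinarith
  · rw [div_mul_eq_mul_div, le_div_iff₀ hS0]
    have h4 : b = b / ω * ω := by field_simp
    rw [h4]
    nlinarith
  · rw [hee, ← ENNReal.ofReal_add he0 (by positivity)]
    exact ENNReal.ofReal_le_ofReal (by linarith)

/-- Stability for almost maximizers of the Riesz energy. -/
theorem exists_volume_real_diff_ball_le [Nontrivial V] (hN : 2 ≤ finrank ℝ V) {s S : ℝ}
    (hs : 0 < s) (hs' : s < finrank ℝ V) (hS0 : 0 < S)
    (hS : ∀ F : Set V, MeasurableSet F → volume F = volume (ball (0 : V) 1) →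
      mutualEnergy s F F ≤ ENNReal.ofReal S) :
    ∃ κ K : ℝ, 0 < κ ∧ 0 < K ∧ ∀ (D : ℝ) (E : Set V), 0 ≤ D → D ≤ κ → MeasurableSet E →
      volume E = volume (ball (0 : V) 1) →
      ENNReal.ofReal S ≤ mutualEnergy s E E + ENNReal.ofReal D →
      ∃ c : V, volume.real (E \ ball c 1) ≤ K * √D := by
  set ω := volume.real (ball (0 : V) 1) with hω
  have hω0 : 0 < ω := ENNReal.toReal_pos (measure_ball_pos _ _ one_pos).ne' measure_ball_lt_top.ne
  have hωv : volume (ball (0 : V) 1) = ENNReal.ofReal ω :=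
    (ofReal_measureReal measure_ball_lt_top.ne).symm
  obtain ⟨κ, R, hκ, hR, hdiam⟩ := exists_norm_sub_lt_of_lt_potential (V := V) hs hs'
    (show 0 < S / (4 * ω) by positivity) hω0
  obtain ⟨K, hK, hstab⟩ := exists_volume_diff_ball_le hN hs hs' (V := V)
    (show 0 < 2 * R by positivity)
  refine ⟨min κ (min (S / 4) 1), 2 * ω / S + K * √2, by positivity, by positivity,
    fun D E hD hDκ hE hEv hED ↦ ?_⟩
  obtain ⟨hDκ, hDS, hD1⟩ := by simpa only [le_min_iff] using hDκ
  have hE' : volume E ≠ ∞ := by rw [hEv]; exact measure_ball_lt_top.ne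
  set G := E ∩ {x | ENNReal.ofReal (S / (4 * ω)) < ∫⁻ y in E, rieszKernel s x y} with hG
  obtain ⟨r, hr, hr1, hGr, hGE, hGD⟩ := exists_volume_truncation_eq hs hs' hS0 hS hD hDS hE hEv
    hED hG
  have hGm : MeasurableSet G :=
    hE.inter (measurableSet_lt measurable_const (measurable_potential s E))
  have hG0 : volume G ≠ 0 := by
    rw [hGr]
    exact (measure_ball_pos _ _ (by linarith)).ne'
  have hG' : volume G ≠ ∞ := measure_ne_top_of_subset inter_subset_left hE'
  obtain ⟨x₀, hx₀⟩ := nonempty_of_measure_ne_zero hG0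
  have hball : ∀ x ∈ G, x ∈ ball x₀ R := fun x hx ↦ mem_ball_iff_norm.2 <|
    hdiam D E hDκ hE (hEv.trans hωv) (fun F hF hFv ↦ (hS F hF (hFv.trans hEv)).trans hED) x₀ x
      hx₀.2 hx.2
  have hinteg : IntegrableOn (fun x : V ↦ x) G := by
    refine Measure.integrableOn_of_bounded (M := R + ‖x₀‖) hG'
      aestronglyMeasurable_id ?_
    filter_upwards [ae_restrict_mem hGm] with x hx
    have h1 := mem_ball_iff_norm.1 (hball x hx)
    have h2 := norm_add_le (x - x₀) x₀
    rw [sub_add_cancel] at h2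
    linarith
  set c := ⨍ x in G, x with hc
  have hcx₀ : c ∈ closedBall x₀ R :=
    (convex_closedBall x₀ R).set_average_mem isClosed_closedBall hG0 hG'
      ((ae_restrict_mem hGm).mono fun x hx ↦ ball_subset_closedBall (hball x hx)) hinteg
  have hmp : MeasurePreserving (fun x : V ↦ x + c) volume volume :=
    measurePreserving_add_right volume c
  have hFm : MeasurableSet ((fun x ↦ x + c) ⁻¹' G) := hmp.measurable hGm
  have hFv : volume ((fun x ↦ x + c) ⁻¹' G) = volume (ball (0 : V) r) := by
    rw [hmp.measure_preimage hGm.nullMeasurableSet, hGr]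
  have hF := hstab (2 * D) r ((fun x ↦ x + c) ⁻¹' G) (by positivity) hr hFm (fun x hx ↦ by
      have h1 := mem_ball_iff_norm.1 (hball _ hx)
      have h2 := mem_closedBall_iff_norm.1 hcx₀
      rw [mem_ball_zero_iff]
      have h3 := norm_sub_le (x + c - x₀) (c - x₀)
      rw [show x + c - x₀ - (c - x₀) = x by abel] at h3
      linarith) (by
      have h1 : ∫ x in (fun x ↦ x + c) ⁻¹' G, (x + c) - c = ∫ x in G, x - c :=
        hmp.setIntegral_preimage_emb (MeasurableEquiv.addRight c).measurableEmbedding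
          (fun x ↦ x - c) G
      simp only [add_sub_cancel_right] at h1
      have : IsFiniteMeasure (volume.restrict G) := ⟨by simpa using hG'.lt_top⟩
      rw [h1]
      exact integral_sub_average (volume.restrict G) fun x ↦ x) hFv (fun F' hF' hFv' ↦ by
      rw [mutualEnergy_preimage s hmp (fun x y ↦ by simp) hGm hGm]
      refine le_trans ?_ hGD
      refine (mutualEnergy_le_of_volume_eq_ball hs' hS (by linarith) hr1 hF'
        (hFv'.trans hFv)).trans ?_
      refine mul_le_of_le_one_left' ?_
      rw [← ENNReal.ofReal_one]
      exact ENNReal.ofReal_le_ofReal (pow_le_one₀ (by linarith) hr1))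
  refine ⟨c, ?_⟩
  have hFc : volume.real ((fun x ↦ x + c) ⁻¹' G \ ball 0 r) = volume.real (G \ ball c r) := by
    rw [← hmp.measureReal_preimage (hGm.diff measurableSet_ball).nullMeasurableSet]
    congr 1
    ext x
    simp
  have h1 : volume.real (E \ ball c 1) ≤ volume.real (E \ G) + volume.real (G \ ball c r) := by
    refine le_trans (measureReal_mono (fun x hx ↦ ?_) (measure_union_ne_top
      (measure_ne_top_of_subset sdiff_subset hE') (measure_ne_top_of_subset sdiff_subset hG')))
      (measureReal_union_le _ _)
    by_cases h : x ∈ G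
    · exact .inr ⟨h, fun h' ↦ hx.2 (ball_subset_ball hr1 h')⟩
    · exact .inl ⟨hx.1, h⟩
  have h2 : D ≤ √D := Real.le_sqrt_of_sq_le (by nlinarith)
  rw [hFc, Real.sqrt_mul (by norm_num)] at hF
  calc volume.real (E \ ball c 1) ≤ 2 * ω / S * D + K * (√2 * √D) := by linarith
    _ ≤ 2 * ω / S * √D + K * (√2 * √D) := by gcongr
    _ = _ := by ring

theorem mutualEnergy_ball_ne_zero [Nontrivial V] {s : ℝ} (hs : 0 < s) :
    mutualEnergy s (ball (0 : V) 1) (ball 0 1) ≠ 0 := by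
  set ω := volume.real (ball (0 : V) 1) with hω
  have hω0 : 0 < ω := ENNReal.toReal_pos (measure_ball_pos _ _ one_pos).ne' measure_ball_lt_top.ne
  have h : ENNReal.ofReal (2 ^ (-s) * ω * ω) ≤ mutualEnergy s (ball (0 : V) 1) (ball 0 1) := by
    refine ofReal_mul_le_setLIntegral measurableSet_ball (by positivity) (fun x hx ↦ ?_) hω.le
    refine le_trans ?_ (lintegral_mono_set (sdiff_subset (s := ball (0 : V) 1) (t := {x})))
    refine ofReal_mul_le_setLIntegral (measurableSet_ball.diff (measurableSet_singleton x))
      (by positivity) (fun y hy ↦ ?_) ?_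
    · refine le_rieszKernel_of_norm_le hs (fun h ↦ hy.2 h.symm) ?_
      have h1 := mem_ball_zero_iff.1 hx
      have h2 := mem_ball_zero_iff.1 hy.1
      linarith [norm_sub_le x y]
    · rw [hω, Measure.real, Measure.real, measure_sdiff_null (measure_singleton x)]
  have h' : 0 < ENNReal.ofReal (2 ^ (-s) * ω * ω) := ENNReal.ofReal_pos.2 (by positivity)
  exact (h'.trans_le h).ne'

/-- The Riesz rearrangement inequality for the Riesz energy of sets. -/
theorem mutualEnergy_le_ball [Nontrivial V] (hN : 2 ≤ finrank ℝ V) {s : ℝ}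
    (hs : 0 < s) (hs' : s < finrank ℝ V) {F : Set V} (hF : MeasurableSet F)
    (hFv : volume F = volume (ball (0 : V) 1)) :
    mutualEnergy s F F ≤ mutualEnergy s (ball (0 : V) 1) (ball 0 1) := by
  obtain ⟨C, hC, hCE⟩ := exists_potential_le (V := V) hs hs'
  set M := C + volume (ball (0 : V) 1) with hM
  have hMtop : M ≠ ∞ := ENNReal.add_ne_top.2 ⟨hC, measure_ball_lt_top.ne⟩
  have hME : ∀ E : Set V, MeasurableSet E → volume E = volume (ball (0 : V) 1) → ∀ A,
      mutualEnergy s A E ≤ M * volume A := fun E hE hEv A ↦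
    mutualEnergy_le (fun x ↦ hM ▸ hEv ▸ hCE E x hE) A
  set T := ⨆ E : {E : Set V // MeasurableSet E ∧ volume E = volume (ball (0 : V) 1)},
    mutualEnergy s E.1 E.1 with hT
  have hTE : ∀ E : Set V, MeasurableSet E → volume E = volume (ball (0 : V) 1) →
      mutualEnergy s E E ≤ T := fun E hE hEv ↦
    le_iSup (fun E : {E : Set V // MeasurableSet E ∧ volume E = volume (ball (0 : V) 1)} ↦
      mutualEnergy s E.1 E.1) ⟨E, hE, hEv⟩
  have hTtop : T ≠ ∞ := by
    refine ne_top_of_le_ne_top (b := M * volume (ball (0 : V) 1))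
      (ENNReal.mul_ne_top hMtop measure_ball_lt_top.ne) (iSup_le fun E ↦ ?_)
    exact (hME _ E.2.1 E.2.2 _).trans_eq (by rw [E.2.2])
  have hT0 : T ≠ 0 := fun h ↦ mutualEnergy_ball_ne_zero (V := V) hs
    (le_zero_iff.1 (h ▸ hTE _ measurableSet_ball rfl))
  obtain ⟨κ, K, hκ, hK, hstab⟩ := exists_volume_real_diff_ball_le hN hs hs'
    (ENNReal.toReal_pos hT0 hTtop) (by simpa only [ENNReal.ofReal_toReal hTtop] using hTE)
  rw [ENNReal.ofReal_toReal hTtop] at hstab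
  refine (hTE F hF hFv).trans ?_
  have hlim : Filter.Tendsto (fun D : ℝ ↦ mutualEnergy s (ball (0 : V) 1) (ball 0 1) +
      ENNReal.ofReal (2 * M.toReal * (K * √D) + D)) (nhdsWithin 0 (Ioi 0))
      (nhds (mutualEnergy s (ball (0 : V) 1) (ball 0 1))) := by
    have h1 : Filter.Tendsto (fun D : ℝ ↦ 2 * M.toReal * (K * √D) + D) (nhds 0) (nhds 0) := by
      have : Continuous fun D : ℝ ↦ 2 * M.toReal * (K * √D) + D := by fun_prop
      simpa using this.tendsto 0
    simpa using tendsto_const_nhds.add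
      ((ENNReal.tendsto_ofReal h1).mono_left nhdsWithin_le_nhds)
  refine ge_of_tendsto hlim ?_
  filter_upwards [Ioc_mem_nhdsGT hκ] with D hD
  have hD' : ENNReal.ofReal D ≠ 0 := (ENNReal.ofReal_pos.2 hD.1).ne'
  obtain ⟨⟨E, hE, hEv⟩, hET⟩ := lt_iSup_iff.1 (hT ▸ ENNReal.sub_lt_self hTtop hT0 hD')
  have hED : T ≤ mutualEnergy s E E + ENNReal.ofReal D := tsub_le_iff_right.1 hET.le
  obtain ⟨c, hc⟩ := hstab D E hD.1.le hD.2 hE hEv hED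
  have hE' : volume E ≠ ∞ := by rw [hEv]; exact measure_ball_lt_top.ne
  have h1 := mutualEnergy_self_le s hE (hE.inter measurableSet_ball)
    (inter_subset_left (s := E) (t := ball c 1))
  rw [sdiff_self_inter] at h1
  have h2 : mutualEnergy s (E ∩ ball c 1) (E ∩ ball c 1) ≤
      mutualEnergy s (ball (0 : V) 1) (ball 0 1) := by
    refine (mutualEnergy_mono s inter_subset_right inter_subset_right).trans_eq ?_
    rw [← mutualEnergy_preimage s (measurePreserving_add_right volume c) (fun x y ↦ by simp)
      measurableSet_ball measurableSet_ball]
    simp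
  have h3 : volume (E \ ball c 1) ≤ ENNReal.ofReal (K * √D) := by
    rw [← ofReal_measureReal (measure_ne_top_of_subset sdiff_subset hE')]
    exact ENNReal.ofReal_le_ofReal hc
  calc T ≤ mutualEnergy s E E + ENNReal.ofReal D := hED
    _ ≤ mutualEnergy s (ball (0 : V) 1) (ball 0 1) + 2 * (M * ENNReal.ofReal (K * √D)) +
          ENNReal.ofReal D := by
        gcongr
        refine h1.trans (add_le_add h2 ?_)
        gcongr
        exact (hME E hE hEv _).trans (by gcongr)
    _ = _ := by
        rw [ENNReal.ofReal_add (by positivity) hD.1.le,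
          ENNReal.ofReal_mul (p := 2 * M.toReal) (by positivity),
          ENNReal.ofReal_mul (p := 2) zero_le_two, ENNReal.ofReal_ofNat,
          ENNReal.ofReal_toReal hMtop, mul_assoc, add_assoc]

/-- Sharp quantitative stability of balls as maximizers of the Riesz energy. -/
theorem exists_volume_real_symmDiff_ball_le [Nontrivial V] (hN : 2 ≤ finrank ℝ V) {s : ℝ}
    (hs : 0 < s) (hs' : s < finrank ℝ V) :
    ∃ K : ℝ, 0 < K ∧ ∀ E : Set V, MeasurableSet E → volume E = volume (ball (0 : V) 1) →
      ∃ c : V, volume.real (ball c 1 ∆ E) ≤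
        K * √((mutualEnergy s (ball (0 : V) 1) (ball 0 1)).toReal -
          (mutualEnergy s E E).toReal) := by
  set ω := volume.real (ball (0 : V) 1) with hω
  set T := mutualEnergy s (ball (0 : V) 1) (ball 0 1) with hT
  have hTtop : T ≠ ∞ :=
    mutualEnergy_ne_top hs hs' measurableSet_ball measure_ball_lt_top.ne measure_ball_lt_top.ne
  obtain ⟨κ, K, hκ, hK, hstab⟩ := exists_volume_real_diff_ball_le hN hs hs'
    (ENNReal.toReal_pos (mutualEnergy_ball_ne_zero hs) hTtop) (by
      rw [ENNReal.ofReal_toReal hTtop]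
      exact fun F ↦ mutualEnergy_le_ball hN hs hs')
  refine ⟨2 * K + 2 * ω / √κ, by positivity, fun E hE hEv ↦ ?_⟩
  have hE' : volume E ≠ ∞ := by rw [hEv]; exact measure_ball_lt_top.ne
  have hEtop : mutualEnergy s E E ≠ ∞ := mutualEnergy_ne_top hs hs' hE hE' hE'
  have hle := ENNReal.toReal_mono hTtop (mutualEnergy_le_ball hN hs hs' hE hEv)
  have hsymm : ∀ c : V, volume.real (ball c 1 ∆ E) ≤ 2 * volume.real (E \ ball c 1) := fun c ↦ by
    rw [two_mul, symmDiff_def]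
    refine (measureReal_union_le _ _).trans_eq ?_
    congr 1
    refine measureReal_sdiff_comm_of_eq measurableSet_ball hE measure_ball_lt_top.ne ?_
    rw [hEv, Measure.addHaar_ball_center]
  set D := T.toReal - (mutualEnergy s E E).toReal with hD
  have hD0 : 0 ≤ D := sub_nonneg.2 hle
  rcases le_or_gt D κ with h | h
  · obtain ⟨c, hc⟩ := hstab D E hD0 h hE hEv (by
      rw [← ENNReal.ofReal_toReal hEtop, ← ENNReal.ofReal_add ENNReal.toReal_nonneg hD0, hD,
        add_sub_cancel])
    refine ⟨c, (hsymm c).trans ?_⟩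
    have : 0 ≤ 2 * ω / √κ * √D := by positivity
    linarith
  · refine ⟨0, (hsymm 0).trans ?_⟩
    have h1 : volume.real (E \ ball 0 1) ≤ ω := by
      refine (measureReal_mono sdiff_subset hE').trans_eq ?_
      rw [Measure.real, hEv, hω, Measure.real]
    have h2 : 1 ≤ √D / √κ := by
      rw [one_le_div (Real.sqrt_pos.2 hκ)]
      exact Real.sqrt_le_sqrt h.le
    have h3 : 0 ≤ 2 * K * √D := by positivity
    have h4 : 2 * ω ≤ 2 * ω * (√D / √κ) := le_mul_of_one_le_right (by positivity) h2
    calc 2 * volume.real (E \ ball 0 1) ≤ 2 * ω * (√D / √κ) := by linarith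
      _ ≤ 2 * K * √D + 2 * ω * (√D / √κ) := by linarith
      _ = _ := by ring

theorem rieszEnergy_eq_toReal_mutualEnergy {N : ℕ} (hN : 2 ≤ N) {α : ℝ} (hα : 0 < α) (hα' : α < N)
    {E : Set (EuclideanSpace ℝ (Fin N))} (hE : MeasurableSet E) (hE' : volume E ≠ ∞) :
    rieszEnergy N α E = (mutualEnergy (N - α) E E).toReal := by
  have : Nonempty (Fin N) := ⟨⟨0, by omega⟩⟩
  obtain ⟨C, hC, hCE⟩ := exists_potential_le (V := EuclideanSpace ℝ (Fin N)) (s := N - α)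
    (by linarith) (by rw [finrank_euclideanSpace_fin]; linarith)
  have h1 : ∀ x, ∫ y in E, ‖y - x‖ ^ (α - (N : ℝ)) =
      (∫⁻ y in E, rieszKernel (N - α) x y).toReal := by
    intro x
    rw [integral_eq_lintegral_of_nonneg_ae (.of_forall fun y ↦ by positivity)
      (by fun_prop : Measurable fun y ↦ ‖y - x‖ ^ (α - (N : ℝ))).aestronglyMeasurable]
    simp only [rieszKernel, neg_sub, norm_sub_rev x]
  simp only [rieszEnergy, h1]
  exact integral_toReal (measurable_potential _ E).aemeasurable
    (.of_forall fun x ↦ (hCE E x hE).trans_lt (ENNReal.add_lt_top.2 ⟨hC.lt_top, hE'.lt_top⟩))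

end

open Module in
open scoped ENNReal in
theorem reduction_to_nearly_spherical (N : ℕ) (hN : 2 ≤ N) (α : ℝ) (hα₁ : 1 < α) (hα₂ : α < N)
    (ε : ℝ) (hε : 0 < ε) :
    ∃ K : ℝ, 0 < K ∧ ∀ E : Set (EuclideanSpace ℝ (Fin N)), MeasurableSet E →
      volume E = volume (ball (0 : EuclideanSpace ℝ (Fin N)) 1) →
      (asymmetry N E ≤ K * Real.sqrt (deficit N α E)) ∨
      (∃ F : Set (EuclideanSpace ℝ (Fin N)),
        IsNearlySpherical N ε (0 : EuclideanSpace ℝ (Fin N)) F ∧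
        barycenter N F = 0 ∧
        deficit N α F ≤ 2 * deficit N α E ∧
        (volume (F ∆ ball (0 : EuclideanSpace ℝ (Fin N)) 1)).toReal ≥ asymmetry N E / 6) := by
  have : Nonempty (Fin N) := ⟨⟨0, by omega⟩⟩
  have hfr : finrank ℝ (EuclideanSpace ℝ (Fin N)) = N := finrank_euclideanSpace_fin
  obtain ⟨K, hK, h⟩ := exists_volume_real_symmDiff_ball_le (V := EuclideanSpace ℝ (Fin N))
    (s := N - α) (by rw [hfr]; exact hN) (by linarith) (by rw [hfr]; linarith)
  refine ⟨K, hK, fun E hE hEv ↦ .inl ?_⟩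
  obtain ⟨c, hc⟩ := h E hE hEv
  have hE' : volume E ≠ ∞ := by rw [hEv]; exact measure_ball_lt_top.ne
  rw [deficit, rieszEnergy_eq_toReal_mutualEnergy hN (by linarith) hα₂ measurableSet_ball
    measure_ball_lt_top.ne, rieszEnergy_eq_toReal_mutualEnergy hN (by linarith) hα₂ hE hE']
  refine le_trans (ciInf_le ⟨0, ?_⟩ c) hc
  rintro _ ⟨x, rfl⟩
  exact ENNReal.toReal_nonneg
end

section
/- Let N ≥ 2 and 1 < α < N. For any three points x, y, z ∈ ℝ^N with y ≠ x, one has |y−x|^{α−N} − |z−x|^{α−N} ≤ (N−α+1) · min(1, |y−z|) / min(|y−x|^{N−α+1}, |y−x|^{N−α}). -/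
open MeasureTheory Metric

/-- Tangent-line bound for the convex function `t ↦ t ^ (-s)` on the positive half-line. -/
theorem rpow_neg_sub_rpow_neg_le {a b s : ℝ} (ha : 0 < a) (hb : 0 < b) (hs : 0 ≤ s) :
    a ^ (-s) - b ^ (-s) ≤ s * (b - a) / a ^ (s + 1) := by
  have hlog : Real.log (b / a) ≤ b / a - 1 := Real.log_le_sub_one_of_pos (div_pos hb ha)
  have hexp : 1 - s * (b / a - 1) ≤ (b / a) ^ (-s) := by
    rw [Real.rpow_def_of_pos (div_pos hb ha)]
    nlinarith [Real.add_one_le_exp (Real.log (b / a) * -s), mul_le_mul_of_nonneg_left hlog hs]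
  have hb_eq : b ^ (-s) = (b / a) ^ (-s) * a ^ (-s) := by
    rw [← Real.mul_rpow (div_pos hb ha).le ha.le, div_mul_cancel₀ b ha.ne']
  have hrhs : s * (b - a) / a ^ (s + 1) = s * (b / a - 1) * a ^ (-s) := by
    rw [Real.rpow_add_one ha.ne', Real.rpow_neg ha.le]
    have := (Real.rpow_pos_of_pos ha s).ne'
    field_simp
  rw [hb_eq, hrhs]
  nlinarith [mul_le_mul_of_nonneg_right hexp (Real.rpow_nonneg ha.le (-s))]

theorem kernel_difference_bound (N : ℕ) (hN : 2 ≤ N) (α : ℝ) (hα₁ : 1 < α) (hα₂ : α < N)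
    (x y z : EuclideanSpace ℝ (Fin N)) (hyx : y ≠ x) :
    ‖y - x‖ ^ (α - (N : ℝ)) - ‖z - x‖ ^ (α - (N : ℝ)) ≤
      ((N : ℝ) - α + 1) * min 1 ‖y - z‖ /
        min (‖y - x‖ ^ ((N : ℝ) - α + 1)) (‖y - x‖ ^ ((N : ℝ) - α)) := by
  have hs : 0 < (N : ℝ) - α := sub_pos.2 hα₂
  have ha : 0 < ‖y - x‖ := norm_pos_iff.2 (sub_ne_zero.2 hyx)
  have hneg : α - (N : ℝ) = -((N : ℝ) - α) := (neg_sub _ _).symm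
  rw [hneg]
  set s : ℝ := (N : ℝ) - α
  have hm : 0 < min (‖y - x‖ ^ (s + 1)) (‖y - x‖ ^ s) :=
    lt_min (Real.rpow_pos_of_pos ha _) (Real.rpow_pos_of_pos ha _)
  rcases le_total 1 ‖y - z‖ with hd | hd
  · rw [min_eq_left hd, mul_one]
    calc ‖y - x‖ ^ (-s) - ‖z - x‖ ^ (-s) ≤ ‖y - x‖ ^ (-s) :=
          sub_le_self _ (Real.rpow_nonneg (norm_nonneg _) _)
      _ = 1 / ‖y - x‖ ^ s := by rw [Real.rpow_neg ha.le, one_div]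
      _ ≤ (s + 1) / min (‖y - x‖ ^ (s + 1)) (‖y - x‖ ^ s) :=
          div_le_div₀ (by linarith) (by linarith) hm (min_le_right _ _)
  · rw [min_eq_right hd]
    suffices h : ‖y - x‖ ^ (-s) - ‖z - x‖ ^ (-s) ≤ (s + 1) * ‖y - z‖ / ‖y - x‖ ^ (s + 1) from
      h.trans (div_le_div_of_nonneg_left (by positivity) hm (min_le_left _ _))
    rcases eq_or_ne z x with rfl | hzx
    · rw [sub_self, norm_zero, Real.zero_rpow (neg_ne_zero.2 hs.ne'), sub_zero,
        Real.rpow_add_one ha.ne', mul_div_mul_right _ _ ha.ne', Real.rpow_neg ha.le, ← one_div]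
      gcongr
      linarith
    · have htri : ‖z - x‖ - ‖y - x‖ ≤ ‖y - z‖ := by
        simpa [norm_sub_rev z y] using norm_sub_norm_le (z - x) (y - x)
      refine (rpow_neg_sub_rpow_neg_le ha (norm_pos_iff.2 (sub_ne_zero.2 hzx)) hs.le).trans ?_
      refine div_le_div_of_nonneg_right ?_ (by positivity)
      nlinarith [mul_le_mul_of_nonneg_left htri hs.le, norm_nonneg (y - z)]
end

section
/- Let N ≥ 2 and 1 < α < N. There exists a continuous increasing function τ₂ : [0,∞) → [0,∞), depending only on N and α, with τ₂(0) = 0, such that for any three Borel sets G, H, K ⊆ ℝ^N of finite measure with |H| = |K|, and for any invertible transport map Φ between H and K, one has |𝔈(G,H) − 𝔈(G,K)| ≤ τ₂(|G|) · ∫_H min(1, |y − Φ(y)|) dy. -/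
open MeasureTheory Metric

noncomputable def interactionEnergy (N : ℕ) (α : ℝ)
    (G H : Set (EuclideanSpace ℝ (Fin N))) : ℝ :=
  ∫ x in G, ∫ y in H, ‖y - x‖ ^ (α - (N : ℝ))

/-- `Φ` is a transport map between `H` and `K`: it pushes the Lebesgue measure
restricted to `H` forward to the Lebesgue measure restricted to `K`. -/
def IsTransportMap (N : ℕ) (H K : Set (EuclideanSpace ℝ (Fin N)))
    (Φ : EuclideanSpace ℝ (Fin N) → EuclideanSpace ℝ (Fin N)) : Prop :=
  Measurable Φ ∧ Measure.map Φ (volume.restrict H) = volume.restrict K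

/-- `Φ` is an invertible transport map between `H` and `K`. -/
def IsInvertibleTransportMap (N : ℕ) (H K : Set (EuclideanSpace ℝ (Fin N)))
    (Φ : EuclideanSpace ℝ (Fin N) → EuclideanSpace ℝ (Fin N)) : Prop :=
  IsTransportMap N H K Φ ∧
  ∃ Ψ : EuclideanSpace ℝ (Fin N) → EuclideanSpace ℝ (Fin N),
    IsTransportMap N K H Ψ ∧
    (∀ᵐ z ∂(volume.restrict K), Φ (Ψ z) = z) ∧
    (∀ᵐ y ∂(volume.restrict H), Ψ (Φ y) = y)

/-- A Lipschitz-type estimate for `t ↦ t ^ (-s)`, valid also at `t = 0` where `0 ^ (-s)` is the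
junk value `0`. -/
lemma abs_rpow_neg_sub_rpow_neg_le {s a b : ℝ} (hs : 0 < s) (ha : 0 ≤ a) (hb : 0 ≤ b) :
    |a ^ (-s) - b ^ (-s)| ≤ (s + 1) * |a - b| * (a ^ (-(s + 1)) + b ^ (-(s + 1))) := by
  wlog hab : a ≤ b generalizing a b
  · rw [abs_sub_comm, abs_sub_comm a b, add_comm (a ^ _)]
    exact this hb ha (le_of_not_ge hab)
  have hbn : 0 ≤ b ^ (-(s + 1)) := Real.rpow_nonneg hb _
  rcases ha.eq_or_lt with rfl | ha'
  · rw [Real.zero_rpow (by linarith), Real.zero_rpow (by linarith)]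
    rcases hb.eq_or_lt with rfl | hb'
    · simp [Real.zero_rpow (show -s ≠ 0 by linarith)]
    · have h : b ^ (-s) = b * b ^ (-(s + 1)) := by
        rw [← Real.rpow_one_add' hb (by linarith)]; congr 1; ring
      rw [zero_sub, abs_neg, zero_sub, abs_neg, abs_of_nonneg (Real.rpow_nonneg hb _),
        abs_of_nonneg hb, h]
      nlinarith [mul_nonneg hb hbn]
  · have key := (convex_Ici a).norm_image_sub_le_of_norm_hasDerivWithin_le
      (f := fun t : ℝ => t ^ (-s)) (f' := fun t => -s * t ^ (-s - 1)) (C := s * a ^ (-(s + 1)))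
      (fun t ht => (Real.hasDerivAt_rpow_const
        (Or.inl (ha'.trans_le ht).ne')).hasDerivWithinAt) (fun t ht => by
        rw [norm_mul, norm_neg, Real.norm_of_nonneg hs.le,
          Real.norm_of_nonneg (Real.rpow_nonneg (ha.trans ht) _), neg_add']
        exact mul_le_mul_of_nonneg_left
          (Real.rpow_le_rpow_of_nonpos ha' ht (by linarith)) hs.le)
      (Set.mem_Ici.2 hab) (Set.mem_Ici.2 le_rfl)
    simp only [Real.norm_eq_abs] at key
    have han : 0 ≤ a ^ (-(s + 1)) := Real.rpow_nonneg ha _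
    have h0 := abs_nonneg (a - b)
    refine key.trans ?_
    nlinarith [mul_nonneg h0 han, mul_nonneg h0 hbn, mul_nonneg (mul_nonneg hs.le h0) hbn]

lemma norm_rpow_neg_le_indicator_add {E : Type*} [NormedAddCommGroup E] {s r : ℝ} (hs : 0 ≤ s)
    (hr : 0 < r) (x : E) :
    ‖x‖ ^ (-s) ≤ (ball (0 : E) r).indicator (fun x => ‖x‖ ^ (-s)) x + r ^ (-s) := by
  by_cases hx : x ∈ ball (0 : E) r
  · rw [Set.indicator_of_mem hx]
    linarith [Real.rpow_nonneg hr.le (-s)]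
  · rw [Set.indicator_of_notMem hx, zero_add]
    exact Real.rpow_le_rpow_of_nonpos hr (by simpa using hx) (by linarith)

section RieszPotential

variable {E : Type*} [NormedAddCommGroup E] [NormedSpace ℝ E] [FiniteDimensional ℝ E]
  [MeasurableSpace E] [BorelSpace E] (μ : Measure E) [μ.IsAddHaarMeasure]

lemma integrableOn_ball_norm_rpow_neg (hd : 1 ≤ Module.finrank ℝ E) {s : ℝ}
    (hs : s < Module.finrank ℝ E) (r : ℝ) :
    IntegrableOn (fun x : E => ‖x‖ ^ (-s)) (ball 0 r) μ := by
  refine integrableOn_ball_of_norm_le_rpow (C := 1) hd hs (Filter.Eventually.of_forall fun x => ?_)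
    (by fun_prop : Measurable fun x : E => ‖x‖ ^ (-s)).aestronglyMeasurable
  rw [one_mul, Real.norm_of_nonneg (Real.rpow_nonneg (norm_nonneg _) _)]

lemma setIntegral_ball_norm_rpow_neg (s : ℝ) {r : ℝ} (hr : 0 < r) :
    ∫ x in ball (0 : E) r, ‖x‖ ^ (-s) ∂μ =
      r ^ ((Module.finrank ℝ E : ℝ) - s) * ∫ x in ball (0 : E) 1, ‖x‖ ^ (-s) ∂μ := by
  have h := Measure.setIntegral_comp_smul_of_pos μ (fun x : E => ‖x‖ ^ (-s)) (ball 0 1) hr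
  rw [smul_unitBall_of_pos hr] at h
  simp only [norm_smul, Real.norm_of_nonneg hr.le, Real.mul_rpow hr.le (norm_nonneg _),
    smul_eq_mul, integral_const_mul] at h
  rw [sub_eq_add_neg, Real.rpow_add hr, Real.rpow_natCast, mul_assoc, h, mul_inv_cancel_left₀]
  positivity

lemma integrable_indicator_ball_norm_sub_rpow_neg (hd : 1 ≤ Module.finrank ℝ E) {s : ℝ}
    (hs : s < Module.finrank ℝ E) (r : ℝ) (y : E) :
    Integrable (fun x => (ball (0 : E) r).indicator (fun x => ‖x‖ ^ (-s)) (y - x)) μ :=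
  ((integrable_indicator_iff measurableSet_ball).2
    (integrableOn_ball_norm_rpow_neg μ hd hs r)).comp_sub_left y

lemma integrableOn_norm_sub_rpow_neg (hd : 1 ≤ Module.finrank ℝ E) {s : ℝ} (hs₀ : 0 ≤ s)
    (hs : s < Module.finrank ℝ E) {G : Set E} (hG : μ G ≠ ⊤) (y : E) :
    IntegrableOn (fun x => ‖y - x‖ ^ (-s)) G μ := by
  refine Integrable.mono' ((integrable_indicator_ball_norm_sub_rpow_neg μ hd hs 1 y).integrableOn.add
    (integrableOn_const (C := (1 : ℝ) ^ (-s)) hG))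
    (by fun_prop : Measurable fun x : E => ‖y - x‖ ^ (-s)).aestronglyMeasurable
    (Filter.Eventually.of_forall fun x => ?_)
  rw [Real.norm_of_nonneg (Real.rpow_nonneg (norm_nonneg _) _)]
  exact norm_rpow_neg_le_indicator_add hs₀ one_pos (y - x)

/-- The Riesz potential of a set of finite measure is bounded by a power of the measure. -/
lemma setIntegral_norm_sub_rpow_neg_le (hd : 1 ≤ Module.finrank ℝ E) {s : ℝ} (hs₀ : 0 ≤ s)
    (hs : s < Module.finrank ℝ E) {G : Set E} (hG : μ G ≠ ⊤) (y : E) :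
    ∫ x in G, ‖y - x‖ ^ (-s) ∂μ ≤
      ((∫ x in ball (0 : E) 1, ‖x‖ ^ (-s) ∂μ) + 1) *
        μ.real G ^ (((Module.finrank ℝ E : ℝ) - s) / Module.finrank ℝ E) := by
  set n : ℝ := (Module.finrank ℝ E : ℝ) with hn
  have hn0 : 0 < n := by rw [hn]; exact_mod_cast hd
  have hI : 0 ≤ ∫ x in ball (0 : E) 1, ‖x‖ ^ (-s) ∂μ :=
    integral_nonneg fun x => Real.rpow_nonneg (norm_nonneg _) _
  rcases (measureReal_nonneg (μ := μ) (s := G)).eq_or_lt with h0 | h0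
  · have : μ G = 0 := by
      rcases (ENNReal.toReal_eq_zero_iff _).1 h0.symm with h | h
      exacts [h, absurd h hG]
    rw [setIntegral_measure_zero _ this]
    exact mul_nonneg (by linarith) (Real.rpow_nonneg measureReal_nonneg _)
  set r := μ.real G ^ (1 / n) with hr
  have hr0 : 0 < r := Real.rpow_pos_of_pos h0 _
  have hg := integrable_indicator_ball_norm_sub_rpow_neg μ hd hs r y
  calc ∫ x in G, ‖y - x‖ ^ (-s) ∂μ
      ≤ ∫ x in G, ((ball (0 : E) r).indicator (fun x => ‖x‖ ^ (-s)) (y - x) + r ^ (-s)) ∂μ :=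
        integral_mono (integrableOn_norm_sub_rpow_neg μ hd hs₀ hs hG y)
          (hg.integrableOn.add (integrableOn_const hG))
          fun x => norm_rpow_neg_le_indicator_add hs₀ hr0 (y - x)
    _ = (∫ x in G, (ball (0 : E) r).indicator (fun x => ‖x‖ ^ (-s)) (y - x) ∂μ)
          + μ.real G * r ^ (-s) := by
        rw [integral_add hg.integrableOn (integrableOn_const hG), setIntegral_const, smul_eq_mul]
    _ ≤ (∫ x, (ball (0 : E) r).indicator (fun x => ‖x‖ ^ (-s)) (y - x) ∂μ)
          + μ.real G * r ^ (-s) := by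
        refine add_le_add_left (setIntegral_le_integral hg ?_) _
        exact (Filter.Eventually.of_forall fun x =>
          Set.indicator_nonneg (fun x _ => Real.rpow_nonneg (norm_nonneg _) _) _)
    _ = r ^ (n - s) * (∫ x in ball (0 : E) 1, ‖x‖ ^ (-s) ∂μ) + μ.real G * r ^ (-s) := by
        rw [integral_sub_left_eq_self, integral_indicator measurableSet_ball,
          setIntegral_ball_norm_rpow_neg μ s hr0]
    _ = _ := by
        have h1 : r ^ n = μ.real G := by
          rw [hr, ← Real.rpow_mul h0.le, one_div_mul_cancel hn0.ne', Real.rpow_one]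
        have h2 : μ.real G * r ^ (-s) = r ^ (n - s) := by
          rw [← h1, ← Real.rpow_add hr0, sub_eq_add_neg]
        have h3 : μ.real G ^ ((n - s) / n) = r ^ (n - s) := by
          rw [hr, ← Real.rpow_mul h0.le]; congr 1; ring
        rw [h2, h3]; ring

lemma abs_setIntegral_norm_sub_rpow_neg_sub_le (hd : 1 ≤ Module.finrank ℝ E) {s : ℝ} (hs₀ : 0 < s)
    (hs : s + 1 < Module.finrank ℝ E) {G : Set E} (hG : μ G ≠ ⊤) (y z : E) :
    |(∫ x in G, ‖y - x‖ ^ (-s) ∂μ) - ∫ x in G, ‖z - x‖ ^ (-s) ∂μ| ≤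
      (s + 1) * ‖y - z‖ *
        ((∫ x in G, ‖y - x‖ ^ (-(s + 1)) ∂μ) + ∫ x in G, ‖z - x‖ ^ (-(s + 1)) ∂μ) := by
  have hi (w : E) := integrableOn_norm_sub_rpow_neg μ hd hs₀.le (by linarith) hG w
  have hj (w : E) := integrableOn_norm_sub_rpow_neg μ hd (by linarith) hs hG w
  rw [← integral_sub (hi y) (hi z), ← integral_add (hj y) (hj z), ← integral_const_mul,
    ← Real.norm_eq_abs]
  refine norm_integral_le_of_norm_le (((hj y).add (hj z)).const_mul _)
    (Filter.Eventually.of_forall fun x => ?_)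
  rw [Real.norm_eq_abs]
  refine (abs_rpow_neg_sub_rpow_neg_le hs₀ (norm_nonneg (y - x)) (norm_nonneg (z - x))).trans ?_
  have h := abs_norm_sub_norm_le (y - x) (z - x)
  rw [sub_sub_sub_cancel_right] at h
  have hp := add_nonneg (Real.rpow_nonneg (norm_nonneg (y - x)) (-(s + 1)))
    (Real.rpow_nonneg (norm_nonneg (z - x)) (-(s + 1)))
  gcongr

lemma exists_abs_setIntegral_norm_sub_rpow_neg_sub_le_min (hd : 1 ≤ Module.finrank ℝ E) {s : ℝ}
    (hs₀ : 0 < s) (hs : s + 1 < Module.finrank ℝ E) :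
    ∃ τ : ℝ → ℝ, Continuous τ ∧ Monotone τ ∧ τ 0 = 0 ∧ ∀ G : Set E, μ G ≠ ⊤ → ∀ y z : E,
      |(∫ x in G, ‖y - x‖ ^ (-s) ∂μ) - ∫ x in G, ‖z - x‖ ^ (-s) ∂μ| ≤
        τ (μ.real G) * min 1 ‖y - z‖ := by
  set n : ℝ := (Module.finrank ℝ E : ℝ) with hn
  have hn0 : 0 < n := by linarith
  set A := (∫ x in ball (0 : E) 1, ‖x‖ ^ (-s) ∂μ) + 1 with hA
  set B := (∫ x in ball (0 : E) 1, ‖x‖ ^ (-(s + 1)) ∂μ) + 1 with hB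
  have hI (t : ℝ) : 0 ≤ ∫ x in ball (0 : E) 1, ‖x‖ ^ (-t) ∂μ :=
    integral_nonneg fun x => Real.rpow_nonneg (norm_nonneg _) _
  have hA0 : 0 ≤ A := by linarith [hI s]
  have hB0 : 0 ≤ B := by linarith [hI (s + 1)]
  have hp : 0 < (n - s) / n := div_pos (by linarith) hn0
  have hq : 0 < (n - (s + 1)) / n := div_pos (by linarith) hn0
  refine ⟨fun t => A * max t 0 ^ ((n - s) / n) + 2 * (s + 1) * B * max t 0 ^ ((n - (s + 1)) / n),
    ?_, ?_, ?_, ?_⟩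
  · have h (p : ℝ) (hp : 0 < p) : Continuous fun t : ℝ => max t 0 ^ p :=
      (continuous_id.max continuous_const).rpow_const fun _ => Or.inr hp.le
    exact ((h _ hp).const_mul _).add ((h _ hq).const_mul _)
  · intro a b hab
    have h := max_le_max_right 0 hab
    dsimp only
    gcongr
  · simp [Real.zero_rpow hp.ne', Real.zero_rpow hq.ne']
  · intro G hG y z
    dsimp only
    rw [max_eq_left measureReal_nonneg]
    have hnn (w : E) : 0 ≤ ∫ x in G, ‖w - x‖ ^ (-s) ∂μ :=
      integral_nonneg fun x => Real.rpow_nonneg (norm_nonneg _) _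
    have h1 (w : E) := setIntegral_norm_sub_rpow_neg_le μ hd hs₀.le (by linarith) hG w
    have h2 (w : E) := setIntegral_norm_sub_rpow_neg_le μ hd (by linarith) hs hG w
    rw [← hn, ← hA] at h1
    rw [← hn, ← hB] at h2
    have hP := mul_nonneg hA0 (Real.rpow_nonneg (measureReal_nonneg (μ := μ) (s := G)) ((n - s) / n))
    have hQ := mul_nonneg hB0
      (Real.rpow_nonneg (measureReal_nonneg (μ := μ) (s := G)) ((n - (s + 1)) / n))
    rcases le_total 1 ‖y - z‖ with h | h
    · rw [min_eq_left h, mul_one]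
      have := abs_sub_le_of_nonneg_of_le (hnn y) (h1 y) (hnn z) (h1 z)
      nlinarith
    · rw [min_eq_right h]
      refine (abs_setIntegral_norm_sub_rpow_neg_sub_le μ hd hs₀ hs hG y z).trans ?_
      have h3 := mul_le_mul_of_nonneg_left (add_le_add (h2 y) (h2 z))
        (mul_nonneg (show 0 ≤ s + 1 by linarith) (norm_nonneg (y - z)))
      nlinarith [mul_nonneg hP (norm_nonneg (y - z))]

/-- The kernel is integrable on a product of sets of finite measure. -/
lemma integrable_norm_sub_rpow_neg_prod (hd : 1 ≤ Module.finrank ℝ E) {s : ℝ} (hs₀ : 0 ≤ s)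
    (hs : s < Module.finrank ℝ E) {G H : Set E} (hG : μ G ≠ ⊤) (hH : μ H ≠ ⊤) :
    Integrable (Function.uncurry fun x y : E => ‖y - x‖ ^ (-s))
      ((μ.restrict G).prod (μ.restrict H)) := by
  have hm : StronglyMeasurable (Function.uncurry fun x y : E => ‖y - x‖ ^ (-s)) :=
    (by fun_prop : Measurable fun p : E × E => ‖p.2 - p.1‖ ^ (-s)).stronglyMeasurable
  refine (integrable_prod_iff' hm.aestronglyMeasurable).2
    ⟨Filter.Eventually.of_forall (integrableOn_norm_sub_rpow_neg μ hd hs₀ hs hG), ?_⟩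
  refine Integrable.mono' (integrableOn_const (C :=
      ((∫ x in ball (0 : E) 1, ‖x‖ ^ (-s) ∂μ) + 1) *
        μ.real G ^ (((Module.finrank ℝ E : ℝ) - s) / Module.finrank ℝ E)) hH)
    hm.norm.integral_prod_left'.aestronglyMeasurable (Filter.Eventually.of_forall fun y => ?_)
  have hnn (x : E) : 0 ≤ ‖y - x‖ ^ (-s) := Real.rpow_nonneg (norm_nonneg _) _
  simp only [Function.uncurry_apply_pair, Real.norm_of_nonneg (hnn _)]
  rw [Real.norm_of_nonneg (integral_nonneg hnn)]
  exact setIntegral_norm_sub_rpow_neg_le μ hd hs₀ hs hG y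

end RieszPotential

theorem interaction_energy_transport_bound (N : ℕ) (hN : 2 ≤ N) (α : ℝ)
    (hα₁ : 1 < α) (hα₂ : α < N) :
    ∃ τ₂ : ℝ → ℝ, Continuous τ₂ ∧ Monotone τ₂ ∧ τ₂ 0 = 0 ∧
      ∀ G H K : Set (EuclideanSpace ℝ (Fin N)),
        MeasurableSet G → MeasurableSet H → MeasurableSet K →
        volume G ≠ ⊤ → volume H ≠ ⊤ → volume K ≠ ⊤ → volume H = volume K →
        ∀ Φ : EuclideanSpace ℝ (Fin N) → EuclideanSpace ℝ (Fin N),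
          IsInvertibleTransportMap N H K Φ →
          |interactionEnergy N α G H - interactionEnergy N α G K| ≤
            τ₂ ((volume G).toReal) * ∫ y in H, min 1 ‖y - Φ y‖ := by
  obtain ⟨s, rfl⟩ : ∃ s : ℝ, α = N - s := ⟨N - α, by ring⟩
  have hfin : Module.finrank ℝ (EuclideanSpace ℝ (Fin N)) = N := finrank_euclideanSpace_fin
  have hd : 1 ≤ Module.finrank ℝ (EuclideanSpace ℝ (Fin N)) := by omega
  have hs₀ : 0 < s := by linarith
  have hs : s + 1 < (Module.finrank ℝ (EuclideanSpace ℝ (Fin N)) : ℝ) := by rw [hfin]; linarith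
  obtain ⟨τ, hτc, hτm, hτ0, hτ⟩ := exists_abs_setIntegral_norm_sub_rpow_neg_sub_le_min
    (volume : Measure (EuclideanSpace ℝ (Fin N))) hd hs₀ hs
  refine ⟨τ, hτc, hτm, hτ0, fun G H K _ _ _ hG hH hK _ Φ ⟨⟨hΦ, hmap⟩, _⟩ => ?_⟩
  have hint {L : Set (EuclideanSpace ℝ (Fin N))} (hL : volume L ≠ ⊤) :=
    integrable_norm_sub_rpow_neg_prod volume hd hs₀.le (by linarith) hG hL
  have hE {L : Set (EuclideanSpace ℝ (Fin N))} (hL : volume L ≠ ⊤) :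
      interactionEnergy N (N - s) G L = ∫ y in L, ∫ x in G, ‖y - x‖ ^ (-s) := by
    rw [interactionEnergy, sub_sub_cancel_left, integral_integral_swap (hint hL)]
  have hfH : IntegrableOn (fun y => ∫ x in G, ‖y - x‖ ^ (-s)) H := (hint hH).integral_prod_right
  have hfK : Integrable (fun y => ∫ x in G, ‖y - x‖ ^ (-s)) (volume.restrict K) :=
    (hint hK).integral_prod_right
  rw [← hmap] at hfK
  have hfΦ : IntegrableOn (fun y => ∫ x in G, ‖Φ y - x‖ ^ (-s)) H := hfK.comp_measurable hΦ
  rw [hE hH, hE hK, ← hmap, integral_map hΦ.aemeasurable hfK.aestronglyMeasurable,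
    ← integral_sub hfH hfΦ, ← integral_const_mul, ← Real.norm_eq_abs]
  refine norm_integral_le_of_norm_le (Integrable.const_mul ?_ _)
    (Filter.Eventually.of_forall fun y => hτ G hG y (Φ y))
  refine Integrable.mono' (integrableOn_const (C := (1 : ℝ)) hH)
    (by fun_prop : Measurable fun y => min 1 ‖y - Φ y‖).aestronglyMeasurable
    (Filter.Eventually.of_forall fun y => ?_)
  rw [Real.norm_of_nonneg (le_min zero_le_one (norm_nonneg _))]
  exact min_le_left _ _
end
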